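/- arXiv:1411.2712 — 3 statements merged into one kernel-verified Lean document; each statement's English description precedes it below -/
import Mathlib

section
/- Let J be a JB*-algebra with triple product {a,b,c} = (a∘b*)∘c + (c∘b*)∘a − (a∘c)∘b*. If a, b ∈ J are orthogonal (i.e., {a,b,c} = 0 for all c ∈ J), then a ∘ b* = 0 and (a∘a*)∘b = (a∘b)∘a*. Conversely, if a∘b* = 0 and (a∘a*)∘b = (a∘b)∘a* hold in a unital JB*-algebra, then a and b are orthogonal. -/
/-- The triple product `{x,y,z} = (x∘y*)∘z + (z∘y*)∘x − (x∘z)∘y*` of a JB*-algebra. -/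
noncomputable def tp {J : Type*} [NormedAddCommGroup J] [NormedSpace ℂ J]
    (jmul : J →L[ℂ] J →L[ℂ] J) (st : J → J) (x y z : J) : J :=
  jmul (jmul x (st y)) z + jmul (jmul z (st y)) x - jmul (jmul x z) (st y)

/-- The data of a unital JB*-algebra, in the form of a continuous bilinear Jordan product together
with an involution and a unit. -/
structure UnitalJBStar (J : Type*) [NormedAddCommGroup J] [NormedSpace ℂ J] where
  mul : J →L[ℂ] J →L[ℂ] J
  mul_comm : ∀ a b : J, mul a b = mul b a
  jordan : ∀ a b : J, mul (mul a b) (mul a a) = mul a (mul b (mul a a))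
  norm_mul_le : ∀ a b : J, ‖mul a b‖ ≤ ‖a‖ * ‖b‖
  st : J → J
  st_st : ∀ a : J, st (st a) = a
  st_add : ∀ a b : J, st (a + b) = st a + st b
  st_smul : ∀ (r : ℂ) (a : J), st (r • a) = (starRingEnd ℂ r) • st a
  st_mul : ∀ a b : J, st (mul a b) = mul (st a) (st b)
  norm_st : ∀ a : J, ‖st a‖ = ‖a‖
  norm_cube : ∀ a : J,
    ‖mul (mul a (st a)) a + mul (mul a (st a)) a - mul (mul a a) (st a)‖ = ‖a‖ ^ 3
  e : J
  e_mul : ∀ a : J, mul e a = a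

namespace UnitalJBStar

open ContinuousLinearMap

variable {J : Type*} [NormedAddCommGroup J] [NormedSpace ℂ J] (A : UnitalJBStar J)

lemma jordan_linearized (x y z w : J) :
    A.mul x (A.mul (A.mul y z) w) + A.mul y (A.mul (A.mul z x) w) + A.mul z (A.mul (A.mul x y) w) =
      A.mul (A.mul y z) (A.mul x w) + A.mul (A.mul z x) (A.mul y w) +
        A.mul (A.mul x y) (A.mul z w) := by
  have h1 := A.jordan (x + y + z) w
  have h2 := A.jordan (x + y) w
  have h3 := A.jordan (y + z) w
  have h4 := A.jordan (x + z) w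
  have h5 := A.jordan x w
  have h6 := A.jordan y w
  have h7 := A.jordan z w
  simp only [map_add, add_apply] at h1 h2 h3 h4
  have hc := A.mul_comm
  simp only [hc] at h1 h2 h3 h4 h5 h6 h7 ⊢
  linear_combination (norm := module) (-1 / 2 : ℂ) • h1 + (1 / 2 : ℂ) • h2 + (1 / 2 : ℂ) • h3 +
    (1 / 2 : ℂ) • h4 - (1 / 2 : ℂ) • h5 - (1 / 2 : ℂ) • h6 - (1 / 2 : ℂ) • h7

/-- The trilinear triple product of the Jordan algebra, without the involution. -/
noncomputable def tri (x y z : J) : J :=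
  A.mul (A.mul x y) z + A.mul (A.mul z y) x - A.mul (A.mul x z) y

lemma mul_tri (p u v w : J) :
    A.mul p (A.tri u v w) =
      A.tri (A.mul p u) v w - A.tri u (A.mul p v) w + A.tri u v (A.mul p w) := by
  have h1 := A.jordan_linearized p u v w
  have h2 := A.jordan_linearized p w v u
  have h3 := A.jordan_linearized p u w v
  have hc := A.mul_comm
  simp only [tri, map_add, map_sub]
  simp only [hc] at h1 h2 h3 ⊢
  linear_combination (norm := module) h1 + h2 - h3

lemma commutator_mul (x y u v : J) :
    A.mul x (A.mul y (A.mul u v)) - A.mul y (A.mul x (A.mul u v)) =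
      A.mul (A.mul x (A.mul y u) - A.mul y (A.mul x u)) v +
        A.mul u (A.mul x (A.mul y v) - A.mul y (A.mul x v)) := by
  have h1 := A.jordan_linearized x v u y
  have h2 := A.jordan_linearized y v u x
  have hc := A.mul_comm
  simp only [map_sub, sub_apply]
  simp only [hc] at h1 h2 ⊢
  linear_combination (norm := module) h1 - h2

lemma commutator_tri (x y u v w : J) :
    A.mul x (A.mul y (A.tri u v w)) - A.mul y (A.mul x (A.tri u v w)) =
      A.tri (A.mul x (A.mul y u) - A.mul y (A.mul x u)) v w +
      A.tri u (A.mul x (A.mul y v) - A.mul y (A.mul x v)) w +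
      A.tri u v (A.mul x (A.mul y w) - A.mul y (A.mul x w)) := by
  have key : ∀ p q r : J, A.mul x (A.mul y (A.mul (A.mul p q) r)) -
      A.mul y (A.mul x (A.mul (A.mul p q) r)) =
      A.mul (A.mul (A.mul x (A.mul y p) - A.mul y (A.mul x p)) q) r +
      A.mul (A.mul p (A.mul x (A.mul y q) - A.mul y (A.mul x q))) r +
      A.mul (A.mul p q) (A.mul x (A.mul y r) - A.mul y (A.mul x r)) := by
    intro p q r
    rw [commutator_mul, commutator_mul, map_add, add_apply]
  have h1 := key u v w
  have h2 := key w v u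
  have h3 := key u w v
  simp only [tri, map_add, map_sub] at h1 h2 h3 ⊢
  simp only [sub_apply, map_sub] at h1 h2 h3 ⊢
  linear_combination (norm := module) h1 + h2 - h3

lemma tri_eq (x y z : J) :
    A.tri x y z = A.mul (A.mul x y) z + (A.mul x (A.mul y z) - A.mul y (A.mul x z)) := by
  have hc := A.mul_comm
  simp only [tri]
  simp only [hc]
  module

lemma tri_tri (x y u v w : J) :
    A.tri x y (A.tri u v w) =
      A.tri (A.tri x y u) v w - A.tri u (A.tri y x v) w + A.tri u v (A.tri x y w) := by
  have h1 := A.mul_tri (A.mul x y) u v w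
  have h2 := A.commutator_tri x y u v w
  have e1 : ∀ z, A.tri x y z =
    A.mul (A.mul x y) z + (A.mul x (A.mul y z) - A.mul y (A.mul x z)) := A.tri_eq x y
  have e2 : A.tri y x v =
    A.mul (A.mul x y) v - (A.mul x (A.mul y v) - A.mul y (A.mul x v)) := by
    rw [A.tri_eq, A.mul_comm y x]; module
  rw [e1 (A.tri u v w), e1 u, e1 w, e2, h1, h2]
  simp only [tri, map_add, map_sub, add_apply, sub_apply]
  module

end UnitalJBStar

namespace UnitalJBStar

open ContinuousLinearMap

variable {J : Type*} [NormedAddCommGroup J] [NormedSpace ℂ J] (A : UnitalJBStar J)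

lemma mul_e (x : J) : A.mul x A.e = x := by rw [A.mul_comm, A.e_mul]

lemma st_e : A.st A.e = A.e := by
  have h := A.st_mul A.e (A.st A.e)
  rw [A.e_mul, A.st_st, A.mul_e] at h
  exact h.symm

/-- The involution as a real-linear continuous map. -/
noncomputable def stCLM : J →L[ℝ] J :=
  LinearMap.mkContinuous
    { toFun := A.st
      map_add' := A.st_add
      map_smul' := fun r x => by
        simpa [Complex.conj_ofReal] using A.st_smul (r : ℂ) x } 1
    (fun x => by simp [A.norm_st])

lemma st_sub (x y : J) : A.st (x - y) = A.st x - A.st y := A.stCLM.map_sub x y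

lemma st_zero : A.st 0 = 0 := A.stCLM.map_zero

lemma continuous_st : Continuous A.st := A.stCLM.continuous

lemma norm_e_le : ‖A.e‖ ≤ 1 := by
  have h := A.norm_cube A.e
  simp only [A.st_e, A.e_mul, add_sub_cancel_right] at h
  nlinarith [norm_nonneg A.e, sq_nonneg (‖A.e‖ - 1)]

/-- The operator `x ↦ (z ↦ {x, y, z})`, for fixed `y`. -/
noncomputable def box (y : J) : J →L[ℂ] J →L[ℂ] J :=
  A.mul ∘L A.mul (A.st y) + (compL ℂ J J J).flip (A.mul (A.st y)) ∘L A.mul -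
    compL ℂ J J J (A.mul (A.st y)) ∘L A.mul

/-- The operator `z ↦ {x, y, z}` of the triple product. -/
noncomputable def D (x y : J) : J →L[ℂ] J := A.box y x

lemma box_apply (x y : J) : A.box y x = A.D x y := rfl

lemma D_apply (x y z : J) : A.D x y z = A.tri x (A.st y) z := by
  simp only [D, box, tri, sub_apply, add_apply, comp_apply, flip_apply, compL_apply]
  rw [A.mul_comm (A.st y) x, A.mul_comm (A.st y) z, A.mul_comm (A.st y) (A.mul x z),
    A.mul_comm x (A.mul z (A.st y))]

lemma D_symm (x y z : J) : A.D x y z = A.D z y x := by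
  rw [D_apply, D_apply, tri, tri, A.mul_comm x z]
  abel

lemma D_e_mid (x z : J) : A.D x A.e z = A.mul x z := by
  simp [D_apply, tri, A.st_e, A.mul_e, A.mul_comm z x]

lemma D_e_left (y z : J) : A.D A.e y z = A.mul (A.st y) z := by
  simp [D_apply, tri, A.mul_e, A.e_mul]

lemma D_e_right (x y : J) : A.D x y A.e = A.mul x (A.st y) := by
  rw [D_symm, D_e_left, A.mul_comm]

lemma D_sub (x x' y : J) : A.D (x - x') y = A.D x y - A.D x' y := map_sub _ _ _

lemma D_neg (x y : J) : A.D (-x) y = -A.D x y := map_neg _ _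

lemma D_smul (r : ℂ) (x y : J) : A.D (r • x) y = r • A.D x y := map_smul _ _ _

lemma D_zero (y : J) : A.D 0 y = 0 := map_zero _

lemma D_smul_mid (r : ℂ) (x y : J) : A.D x (r • y) = (starRingEnd ℂ r) • A.D x y := by
  ext z
  simp only [smul_apply, D_apply, tri, A.st_smul, map_smul]
  module

lemma D_zero_mid (x : J) : A.D x 0 = 0 := by
  simpa using A.D_smul_mid 0 x 0

lemma norm_D_self (x : J) : ‖A.D x x x‖ = ‖x‖ ^ 3 := by
  rw [D_apply]
  exact A.norm_cube x

lemma norm_D_apply_le (x y z : J) : ‖A.D x y z‖ ≤ 3 * ‖x‖ * ‖y‖ * ‖z‖ := by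
  have key : ∀ p q r : J, ‖A.mul (A.mul p q) r‖ ≤ ‖p‖ * ‖q‖ * ‖r‖ := fun p q r =>
    (A.norm_mul_le _ _).trans (mul_le_mul_of_nonneg_right (A.norm_mul_le _ _) (norm_nonneg _))
  rw [D_apply, tri]
  refine (norm_sub_le _ _).trans ((add_le_add_left (norm_add_le _ _) _).trans ?_)
  have h1 := key x (A.st y) z
  have h2 := key z (A.st y) x
  have h3 := key x z (A.st y)
  rw [A.norm_st] at h1 h2 h3
  nlinarith

lemma continuous_D_apply {X : Type*} [TopologicalSpace X] {f g h : X → J} (hf : Continuous f)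
    (hg : Continuous g) (hh : Continuous h) : Continuous fun t => A.D (f t) (g t) (h t) := by
  simp only [D_apply, tri]
  have := A.continuous_st.comp hg
  simp only [Function.comp_def] at this
  fun_prop

lemma D_D (x y u v w : J) :
    A.D x y (A.D u v w) =
      A.D (A.D x y u) v w - A.D u (A.D y x v) w + A.D u v (A.D x y w) := by
  have h : A.st (A.D y x v) = A.tri (A.st y) x (A.st v) := by
    simp only [D_apply, tri, A.st_add, A.st_sub, A.st_mul, A.st_st]
  simp only [D_apply _ u _ w, h, D_apply _ x, D_apply _ (A.tri _ _ _), D_apply _ u]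
  exact A.tri_tri _ _ _ _ _

lemma D_apply_quad (c b y : J) : A.D c b (A.D c y c) = A.D c (A.D b c y) c := by
  have h1 := A.D_D c b c y c
  have h2 := A.D_D c y c b c
  rw [A.D_symm (A.D c b c)] at h1
  rw [A.D_symm (A.D c y c), A.D_symm y c b] at h2
  linear_combination (norm := module) -(1 / 3 : ℂ) • h1 - (2 / 3 : ℂ) • h2

lemma D_quad_add (x y z w : J) :
    A.D (A.D x y x) z w + A.D (A.D x z x) y w = (2 : ℂ) • A.D x (A.D y x z) w := by
  have h1 := A.D_D x y x z w
  have h2 := A.D_D x z x y w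
  rw [A.D_symm z x y] at h2
  linear_combination (norm := module) -h1 - h2

lemma D_mid_quad (x y z u : J) :
    A.D x (A.D y z y) u + A.D (A.D x y u) y z =
      A.D x y (A.D u y z) + A.D u y (A.D x y z) := by
  have h := A.D_D z y x y u
  rw [A.D_symm z y (A.D x y u), A.D_symm z y x, A.D_symm z y u, A.D_symm (A.D x y z) y u] at h
  linear_combination (norm := module) h

lemma commutator_D (h x b w : J) (hb : A.D h h b = 0) :
    A.D h h (A.D x b w) = A.D (A.D h h x) b w + A.D x b (A.D h h w) := by
  rw [A.D_D, hb, D_zero_mid, zero_apply, sub_zero]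

lemma D_self_comp_sub (c x y : J) :
    A.D c c ∘L A.D x y - A.D x y ∘L A.D c c = A.D (A.D c c x) y - A.D x (A.D c c y) := by
  ext z
  simp only [sub_apply, comp_apply, A.D_D c c x y z]
  abel

lemma D_pow_pow_aux (c : J) (n : ℕ) :
    (∀ i j, i + j = n →
      A.D ((A.D c c ^ i) c) ((A.D c c ^ j) c) = A.D ((A.D c c ^ n) c) c) →
    (∀ i j, i + j = n + 1 →
      A.D ((A.D c c ^ i) c) ((A.D c c ^ j) c) = A.D ((A.D c c ^ (n + 1)) c) c) ∧
    A.D c c ∘L A.D ((A.D c c ^ n) c) c = A.D ((A.D c c ^ n) c) c ∘L A.D c c := by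
  intro hn
  have hs : ∀ k, (A.D c c ^ (k + 1)) c = A.D c c ((A.D c c ^ k) c) := fun k => by
    rw [pow_succ']; rfl
  set κ := A.D c c ∘L A.D ((A.D c c ^ n) c) c - A.D ((A.D c c ^ n) c) c ∘L A.D c c with hκ
  have shift : ∀ i j, i + j = n → A.D ((A.D c c ^ (i + 1)) c) ((A.D c c ^ j) c) =
      A.D ((A.D c c ^ i) c) ((A.D c c ^ (j + 1)) c) + κ := by
    intro i j hij
    rw [hκ, ← hn i j hij, D_self_comp_sub, hs, hs]
    abel
  have lin : ∀ i j, i + j = n + 1 → A.D ((A.D c c ^ i) c) ((A.D c c ^ j) c) =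
      A.D c ((A.D c c ^ (n + 1)) c) + (i : ℂ) • κ := by
    intro i
    induction i with
    | zero => intro j hj; simp at hj; subst hj; simp
    | succ i ih =>
      intro j hj
      rw [shift i j (by omega), ih (j + 1) (by omega)]
      push_cast
      module
  have hq : A.D c ((A.D c c ^ n) c) c = (A.D c c ^ (n + 1)) c := by
    have h := hn 0 n (by omega)
    simp only [pow_zero, one_apply_eq_self] at h
    rw [h, hs, D_symm]
  have hB : A.D (A.D c c c) ((A.D c c ^ n) c) + A.D (A.D c ((A.D c c ^ n) c) c) c =
      (2 : ℂ) • A.D c (A.D c c ((A.D c c ^ n) c)) := by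
    ext w
    simpa using A.D_quad_add c c ((A.D c c ^ n) c) w
  have h1 := lin 1 n (by omega)
  have h2 := lin (n + 1) 0 (by omega)
  rw [hq, ← hs] at hB
  simp only [pow_one, pow_zero, one_apply_eq_self] at h1 h2
  rw [h1, h2] at hB
  have hκ0 : κ = 0 := by
    have h3 : ((n : ℂ) + 2) • κ = 0 := by
      push_cast at hB
      linear_combination (norm := module) hB
    have hne : (n : ℂ) + 2 ≠ 0 := by exact_mod_cast (by omega : n + 2 ≠ 0)
    exact (smul_eq_zero.mp h3).resolve_left hne
  refine ⟨fun i j hij => ?_, sub_eq_zero.mp hκ0⟩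
  rw [lin i j hij, h2, hκ0, smul_zero, smul_zero]

lemma D_pow_pow (c : J) (i j : ℕ) :
    A.D ((A.D c c ^ i) c) ((A.D c c ^ j) c) = A.D ((A.D c c ^ (i + j)) c) c := by
  suffices h : ∀ n i j, i + j = n →
      A.D ((A.D c c ^ i) c) ((A.D c c ^ j) c) = A.D ((A.D c c ^ n) c) c from h _ i j rfl
  intro n
  induction n with
  | zero =>
    intro i j h
    obtain ⟨rfl, rfl⟩ : i = 0 ∧ j = 0 := by omega
    simp
  | succ n ih => exact (A.D_pow_pow_aux c n ih).1

lemma commute_D_pow (c : J) (n : ℕ) : Commute (A.D c c) (A.D ((A.D c c ^ n) c) c) :=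
  (A.D_pow_pow_aux c n fun i j hij => by rw [D_pow_pow, hij]).2

lemma D_pow_pow_pow (c : J) (i j k : ℕ) :
    A.D ((A.D c c ^ i) c) ((A.D c c ^ j) c) ((A.D c c ^ k) c) =
      (A.D c c ^ (i + j + k + 1)) c := by
  have h := ((A.commute_D_pow c (i + j)).symm.pow_right k).eq
  have h' := DFunLike.congr_fun h c
  simp only [mul_apply_eq_comp] at h'
  rw [D_pow_pow, h', A.D_symm _ c c, ← mul_apply_eq_comp, ← mul_apply_eq_comp, ← pow_succ,
    ← pow_add]
  congr 2
  omega

end UnitalJBStar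

section ExpFlow

open NormedSpace

variable {E F : Type*} [NormedAddCommGroup E] [NormedSpace ℂ E] [NormedAddCommGroup F]
  [NormedSpace ℂ F]

lemma hasDerivAt_complexCLM_apply {u : ℝ → E →L[ℂ] F} {f : ℝ → E} {u' : E →L[ℂ] F} {f' : E}
    {t : ℝ} (hu : HasDerivAt u u' t) (hf : HasDerivAt f f' t) :
    HasDerivAt (fun s => u s (f s)) (u' (f t) + u t f') t := by
  have h := ((((ContinuousLinearMap.id ℂ (E →L[ℂ] F)).bilinearRestrictScalars
    ℝ).isBoundedBilinearMap).hasFDerivAt (u t, f t)).comp_hasDerivAt t (hu.prodMk hf)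
  refine h.congr_deriv ?_
  rw [add_comm]
  rfl

lemma HasDerivAt.comp_ofReal_vec {f : ℂ → E} {f' : E} {t : ℝ} (hf : HasDerivAt f f' t) :
    HasDerivAt (fun s : ℝ => f s) f' t := by
  simpa [Function.comp_def] using HasDerivAt.scomp t hf Complex.ofRealCLM.hasDerivAt

lemma HasDerivAt.complexCLM_comp (L : E →L[ℂ] F) {f : ℝ → E} {f' : E} {t : ℝ}
    (hf : HasDerivAt f f' t) : HasDerivAt (fun s => L (f s)) (L f') t :=
  (L.restrictScalars ℝ).hasFDerivAt.comp_hasDerivAt t hf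

variable [CompleteSpace E]

lemma hasDerivAt_exp_smul_apply (S : E →L[ℂ] E) (x : E) (z : ℂ) :
    HasDerivAt (fun w : ℂ => exp (w • S) x) (S (exp (z • S) x)) z := by
  simpa using (hasDerivAt_exp_smul_const' (𝕂 := ℂ) S z).clm_apply (hasDerivAt_const z x)

lemma hasDerivAt_exp_ofReal_smul_apply (S : E →L[ℂ] E) (x : E) (t : ℝ) :
    HasDerivAt (fun s : ℝ => exp ((s : ℂ) • S) x) (S (exp ((t : ℂ) • S) x)) t :=
  (hasDerivAt_exp_smul_apply S x t).comp_ofReal_vec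

lemma exp_neg_smul_apply_exp (S : E →L[ℂ] E) (z : ℂ) (x : E) :
    exp (z • S) (exp (z • (-S)) x) = x := by
  let _ : NormedAlgebra ℚ (E →L[ℂ] E) := NormedAlgebra.restrictScalars ℚ ℂ _
  have h := exp_add_of_commute (𝔸 := E →L[ℂ] E) (x := z • S) (y := z • (-S))
    (((Commute.refl S).neg_right.smul_left z).smul_right z)
  rw [smul_neg, add_neg_cancel, exp_zero] at h
  rw [smul_neg, ← mul_apply_eq_comp, ← h, one_apply_eq_self]

/-- Uniqueness for the linear differential equation generated by `S`. -/
lemma eq_exp_apply_of_hasDerivAt (S : E →L[ℂ] E) {f : ℝ → E}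
    (hf : ∀ t, HasDerivAt f (S (f t)) t) (t : ℝ) : f t = exp ((t : ℂ) • S) (f 0) := by
  have hg : ∀ s : ℝ, HasDerivAt (fun s : ℝ => exp ((s : ℂ) • (-S)) (f s)) 0 s := by
    intro s
    have h := hasDerivAt_complexCLM_apply
      (hasDerivAt_exp_smul_const (𝕂 := ℂ) (-S) (s : ℂ)).comp_ofReal_vec (hf s)
    convert h using 1
    simp
  have hconst := is_const_of_deriv_eq_zero (fun s => (hg s).differentiableAt)
    (fun s => (hg s).deriv) t 0
  simp only [Complex.ofReal_zero, zero_smul, exp_zero, one_apply_eq_self] at hconst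
  rw [← hconst, exp_neg_smul_apply_exp]

lemma norm_exp_le_exp_norm (S : E →L[ℂ] E) : ‖exp S‖ ≤ Real.exp ‖S‖ := by
  have h1 := exp_series_hasSum_exp' (𝕂 := ℂ) S
  have h2 := exp_series_hasSum_exp' (𝕂 := ℝ) ‖S‖
  rw [← congrFun Real.exp_eq_exp_ℝ] at h2
  refine h1.norm_le_of_bounded h2 fun n => ?_
  rw [norm_smul, norm_inv, smul_eq_mul, RCLike.norm_natCast]
  gcongr
  rcases n.eq_zero_or_pos with rfl | hn
  · rw [pow_zero, pow_zero]
    exact ContinuousLinearMap.norm_id_le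
  · exact norm_pow_le' S hn

/-- A vector annihilated by the action on all powers is annihilated along the exponential flow. -/
lemma apply_exp_eq_of_forall_pow {S R : E →L[ℂ] E} {x y : E} (L L' : E →L[ℂ] F)
    (h : ∀ k : ℕ, L ((S ^ k) x) = L' ((R ^ k) y)) (z : ℂ) :
    L (exp (z • S) x) = L' (exp (z • R) y) := by
  have key : ∀ (T : E →L[ℂ] E) (v : E) (M : E →L[ℂ] F),
      HasSum (fun k : ℕ => ((k.factorial : ℂ)⁻¹ * z ^ k) • M ((T ^ k) v)) (M (exp (z • T) v)) := by
    intro T v M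
    have h1 := exp_series_hasSum_exp' (𝕂 := ℂ) (z • T)
    have h2 := M.hasSum (((ContinuousLinearMap.apply ℂ E v).hasSum h1))
    convert h2 using 2 with k
    · simp [smul_pow, mul_smul]
    · rfl
  refine (key S x L).unique ?_
  simp only [h]
  exact key R y L'

end ExpFlow

namespace UnitalJBStar

open ContinuousLinearMap NormedSpace

variable {J : Type*} [NormedAddCommGroup J] [NormedSpace ℂ J] (A : UnitalJBStar J)

lemma hasDerivAt_mul {x y : ℝ → J} {x' y' : J} {t : ℝ} (hx : HasDerivAt x x' t)
    (hy : HasDerivAt y y' t) :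
    HasDerivAt (fun s => A.mul (x s) (y s)) (A.mul x' (y t) + A.mul (x t) y') t :=
  hasDerivAt_complexCLM_apply (hx.complexCLM_comp A.mul) hy

lemma hasDerivAt_D {x y z : ℝ → J} {x' y' z' : J} {t : ℝ} (hx : HasDerivAt x x' t)
    (hy : HasDerivAt y y' t) (hz : HasDerivAt z z' t) :
    HasDerivAt (fun s => A.D (x s) (y s) (z s))
      (A.D x' (y t) (z t) + A.D (x t) y' (z t) + A.D (x t) (y t) z') t := by
  have hy' : HasDerivAt (fun s => A.st (y s)) (A.st y') t :=
    A.stCLM.hasFDerivAt.comp_hasDerivAt t hy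
  simp only [A.D_apply, tri]
  refine HasDerivAt.congr_deriv (((A.hasDerivAt_mul (A.hasDerivAt_mul hx hy') hz).add
    (A.hasDerivAt_mul (A.hasDerivAt_mul hz hy') hx)).sub
    (A.hasDerivAt_mul (A.hasDerivAt_mul hx hz) hy')) ?_
  simp only [map_add, add_apply]
  abel

/-- A bounded operator preserving cubes is contractive. -/
lemma norm_apply_le_of_map_cube (φ : J →L[ℂ] J)
    (hφ : ∀ x, φ (A.D x x x) = A.D (φ x) (φ x) (φ x)) (x : J) : ‖φ x‖ ≤ ‖x‖ := by
  have key : ∀ (k : ℕ) (x : J), ‖φ x‖ ^ 3 ^ k ≤ ‖φ‖ * ‖x‖ ^ 3 ^ k := by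
    intro k
    induction k with
    | zero => intro x; simpa using φ.le_opNorm x
    | succ k ih =>
      intro x
      have h := ih (A.D x x x)
      rw [hφ, norm_D_self, norm_D_self, ← pow_mul, ← pow_mul, ← pow_succ'] at h
      exact h
  by_contra! hlt
  rcases (norm_nonneg x).eq_or_lt with h0 | h0
  · rw [norm_eq_zero.mp h0.symm] at hlt
    simp at hlt
  · obtain ⟨n, hn⟩ := pow_unbounded_of_one_lt ‖φ‖ ((one_lt_div h0).mpr hlt)
    have h1 := key n x
    have h2 : (‖φ x‖ / ‖x‖) ^ 3 ^ n ≤ ‖φ‖ := by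
      rw [div_pow, div_le_iff₀ (by positivity)]
      exact h1
    have h3 : (‖φ x‖ / ‖x‖) ^ n ≤ (‖φ x‖ / ‖x‖) ^ 3 ^ n :=
      pow_le_pow_right₀ ((one_lt_div h0).mpr hlt).le (Nat.lt_pow_self (by norm_num)).le
    linarith

variable [CompleteSpace J]

lemma exp_D_of_derivation {δ : J →L[ℂ] J}
    (hδ : ∀ x y z, δ (A.D x y z) = A.D (δ x) y z + A.D x (δ y) z + A.D x y (δ z))
    (t : ℝ) (x y z : J) :
    exp ((t : ℂ) • δ) (A.D x y z) =
      A.D (exp ((t : ℂ) • δ) x) (exp ((t : ℂ) • δ) y) (exp ((t : ℂ) • δ) z) := by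
  have h := eq_exp_apply_of_hasDerivAt δ (f := fun t : ℝ =>
    A.D (exp ((t : ℂ) • δ) x) (exp ((t : ℂ) • δ) y) (exp ((t : ℂ) • δ) z)) (fun s => by
      rw [hδ]
      exact A.hasDerivAt_D (hasDerivAt_exp_ofReal_smul_apply δ x s)
        (hasDerivAt_exp_ofReal_smul_apply δ y s) (hasDerivAt_exp_ofReal_smul_apply δ z s)) t
  simp only [Complex.ofReal_zero, zero_smul, exp_zero, one_apply_eq_self] at h
  exact h.symm

lemma norm_exp_derivation_le {δ : J →L[ℂ] J}
    (hδ : ∀ x y z, δ (A.D x y z) = A.D (δ x) y z + A.D x (δ y) z + A.D x y (δ z))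
    (t : ℝ) : ‖exp ((t : ℂ) • δ)‖ ≤ 1 :=
  opNorm_le_bound _ zero_le_one fun x => by
    rw [one_mul]
    exact A.norm_apply_le_of_map_cube _ (fun x => A.exp_D_of_derivation hδ t x x x) x

lemma norm_exp_I_smul_D_le (c : J) (t : ℝ) :
    ‖exp (((t : ℂ) * Complex.I) • A.D c c)‖ ≤ 1 := by
  rw [mul_smul]
  refine A.norm_exp_derivation_le (fun x y z => ?_) t
  simp only [smul_apply, D_smul, D_smul_mid, map_smul, A.D_D c c x y z, Complex.conj_I]
  module

lemma norm_exp_I_smul_mul_le {x : J} (hx : A.st x = x) (t : ℝ) :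
    ‖exp (((t : ℂ) * Complex.I) • A.mul x)‖ ≤ 1 := by
  rw [mul_smul]
  refine A.norm_exp_derivation_le (fun u v w => ?_) t
  have h := A.D_D x A.e u v w
  rw [D_e_mid, D_e_mid, D_e_mid, D_e_left, hx] at h
  simp only [smul_apply, D_smul, D_smul_mid, map_smul, h, Complex.conj_I]
  module

end UnitalJBStar

section Lumer

open NormedSpace Filter Topology

variable {E : Type*} [NormedAddCommGroup E] [NormedSpace ℂ E] [CompleteSpace E]

/-- A bound on the numerical range of an operator bounds its exponential. -/
lemma norm_exp_apply_le_of_numericalRange (S : E →L[ℂ] E) {v : ℝ}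
    (hS : ∀ y : E, ∃ F : E →L[ℂ] ℂ, ‖F‖ ≤ 1 ∧ F y = (‖y‖ : ℂ) ∧ ‖F (S y)‖ ≤ v * ‖y‖) (x : E) :
    ‖exp S x‖ ≤ Real.exp v * ‖x‖ := by
  set y : ℝ → E := fun t => exp ((t : ℂ) • S) x with hy
  have hder : ∀ t, HasDerivAt y (S (y t)) t := hasDerivAt_exp_ofReal_smul_apply S x
  have hcont : Continuous y := continuous_iff_continuousAt.mpr fun t => (hder t).continuousAt
  have hbound : ∀ (w : E) (h : ℝ), 0 ≤ h → ‖w‖ - h * v * ‖w‖ ≤ ‖w - h • S w‖ := by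
    intro w h hh
    obtain ⟨F, hF1, hF2, hF3⟩ := hS w
    have h1 : ‖F (w - h • S w)‖ ≤ ‖w - h • S w‖ :=
      (F.le_opNorm _).trans (mul_le_of_le_one_left (norm_nonneg _) hF1)
    have h2 : ‖F w‖ - ‖F (h • S w)‖ ≤ ‖F (w - h • S w)‖ := by
      rw [map_sub]
      exact norm_sub_norm_le _ _
    have h3 : ‖F (h • S w)‖ ≤ h * (v * ‖w‖) := by
      rw [← Complex.coe_smul, map_smul, norm_smul, Complex.norm_real, Real.norm_of_nonneg hh]
      gcongr
    rw [hF2, Complex.norm_real, norm_norm] at h2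
    linarith
  have hslope : ∀ t r : ℝ, v * ‖y t‖ < r →
      ∃ᶠ z in 𝓝[>] t, (z - t)⁻¹ * (‖y z‖ - ‖y t‖) < r := by
    intro t r hr
    refine Eventually.frequently ?_
    have h1 : Tendsto (fun z => v * ‖y z‖ + ‖slope y t z - S (y z)‖) (𝓝[>] t)
        (𝓝 (v * ‖y t‖ + ‖S (y t) - S (y t)‖)) := by
      have hs := (hasDerivAt_iff_tendsto_slope.mp (hder t)).mono_left
        (nhdsWithin_mono t (fun z (hz : t < z) => hz.ne'))
      have h2 : Tendsto y (𝓝[>] t) (𝓝 (y t)) := (hcont.tendsto t).mono_left nhdsWithin_le_nhds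
      exact (h2.norm.const_mul v).add (hs.sub ((S.continuous.tendsto _).comp h2)).norm
    rw [sub_self, norm_zero, add_zero] at h1
    filter_upwards [h1.eventually (gt_mem_nhds hr), self_mem_nhdsWithin] with z hz htz
    have hpos : 0 < z - t := sub_pos.mpr htz
    refine lt_of_le_of_lt ?_ hz
    have h3 := hbound (y z) (z - t) hpos.le
    have h4 : y z - (z - t) • S (y z) = y t + (z - t) • (slope y t z - S (y z)) := by
      rw [smul_sub, sub_smul_slope, vsub_eq_sub]
      abel
    have h5 : ‖y z - (z - t) • S (y z)‖ ≤ ‖y t‖ + (z - t) * ‖slope y t z - S (y z)‖ := by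
      rw [h4]
      refine (norm_add_le _ _).trans ?_
      rw [norm_smul, Real.norm_of_nonneg hpos.le]
    rw [inv_mul_le_iff₀ hpos]
    linarith
  have h := le_gronwallBound_of_liminf_deriv_right_le (f := fun t => ‖y t‖)
    (f' := fun t => v * ‖y t‖) (δ := ‖y 0‖) (K := v) (ε := 0) (a := 0) (b := 1)
    hcont.norm.continuousOn (fun t _ r hr => hslope t r hr) le_rfl (fun t _ => by simp) 1
    (by simp)
  simpa [hy, gronwallBound_ε0, mul_comm] using h

end Lumer

namespace UnitalJBStar

open ContinuousLinearMap NormedSpace Filter Topology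

variable {J : Type*} [NormedAddCommGroup J] [NormedSpace ℂ J] (A : UnitalJBStar J)

/-- States: contractive functionals taking the value one at the unit. -/
def IsState (f : J →L[ℂ] ℂ) : Prop := ‖f‖ ≤ 1 ∧ f A.e = 1

variable {A}

lemma IsState.norm_apply_le {f : J →L[ℂ] ℂ} (hf : A.IsState f) (x : J) : ‖f x‖ ≤ ‖x‖ :=
  (f.le_opNorm x).trans (mul_le_of_le_one_left (norm_nonneg _) hf.1)

section Complete

variable [CompleteSpace J]

lemma IsState.im_eq_zero_and_re_sq_nonneg {f : J →L[ℂ] ℂ} (hf : A.IsState f) {x : J}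
    (hx : A.st x = x) : (f x).im = 0 ∧ 0 ≤ (f (A.mul x x)).re := by
  set S : J →L[ℂ] J := Complex.I • A.mul x with hS
  have hder : ∀ (y : J) (t : ℝ), HasDerivAt (fun s : ℝ => (f (exp ((s : ℂ) • S) y)).re)
      (f (exp ((t : ℂ) • S) (S y))).re t := by
    intro y t
    have h := ((hasDerivAt_exp_smul_const (𝕂 := ℂ) S (t : ℂ)).comp_ofReal_vec)
    have h2 := hasDerivAt_complexCLM_apply h (hasDerivAt_const t y)
    have h3 := Complex.reCLM.hasFDerivAt.comp_hasDerivAt t (h2.complexCLM_comp f)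
    simpa [Function.comp_def] using h3
  set g : ℝ → ℝ := fun s => (f (exp ((s : ℂ) • S) A.e)).re with hg
  have hg0 : g 0 = 1 := by simp [hg, hf.2]
  have hle : ∀ s, g s ≤ 1 := by
    intro s
    refine (Complex.re_le_norm _).trans ((hf.norm_apply_le _).trans ?_)
    rw [hS, smul_smul]
    refine (le_opNorm _ _).trans ?_
    exact mul_le_one₀ (A.norm_exp_I_smul_mul_le hx s) (norm_nonneg _) A.norm_e_le
  have hmax : IsLocalMax g 0 := Eventually.of_forall fun s => by rw [hg0]; exact hle s
  have hd1 : deriv g = fun t : ℝ => (f (exp ((t : ℂ) • S) (S A.e))).re :=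
    funext fun t => (hder A.e t).deriv
  have hd2 : deriv (deriv g) 0 = -(f (A.mul x x)).re := by
    rw [hd1, (hder (S A.e) 0).deriv]
    simp [hS, A.mul_e]
  have h0 := hmax.deriv_eq_zero
  refine ⟨?_, ?_⟩
  · rw [hd1] at h0
    simpa [hS, A.mul_e] using h0
  · by_contra! hneg
    have hmin := isLocalMin_of_deriv_deriv_pos (f := g) (x₀ := 0) (by rw [hd2]; linarith) h0
      (hder A.e 0).continuousAt
    have hconst : g =ᶠ[𝓝 0] fun _ => g 0 := by
      filter_upwards [hmax, hmin] with s h1 h2 using le_antisymm h1 h2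
    have hz := hconst.deriv.deriv_eq
    rw [hd2] at hz
    simp at hz
    linarith

lemma IsState.apply_st {f : J →L[ℂ] ℂ} (hf : A.IsState f) (x : J) :
    f (A.st x) = starRingEnd ℂ (f x) := by
  have h1 := (hf.im_eq_zero_and_re_sq_nonneg (x := x + A.st x)
    (by rw [A.st_add, A.st_st, add_comm])).1
  have h2 := (hf.im_eq_zero_and_re_sq_nonneg (x := Complex.I • (x - A.st x))
    (by rw [A.st_smul, A.st_sub, A.st_st, Complex.conj_I]; module)).1
  simp at h1 h2
  apply Complex.ext
  · simp; linarith
  · simp; linarith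

lemma IsState.re_mul_st_nonneg {f : J →L[ℂ] ℂ} (hf : A.IsState f) (x : J) :
    0 ≤ (f (A.mul x (A.st x))).re := by
  have h1 := (hf.im_eq_zero_and_re_sq_nonneg (x := x + A.st x)
    (by rw [A.st_add, A.st_st, add_comm])).2
  have h2 := (hf.im_eq_zero_and_re_sq_nonneg (x := Complex.I • (x - A.st x))
    (by rw [A.st_smul, A.st_sub, A.st_st, Complex.conj_I]; module)).2
  have h3 : A.mul (x + A.st x) (x + A.st x) +
      A.mul (Complex.I • (x - A.st x)) (Complex.I • (x - A.st x)) =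
      (4 : ℂ) • A.mul x (A.st x) := by
    have hI : A.mul (Complex.I • (x - A.st x)) (Complex.I • (x - A.st x)) =
        -A.mul (x - A.st x) (x - A.st x) := by
      rw [map_smul, map_smul, smul_apply, smul_smul, Complex.I_mul_I, neg_one_smul]
    rw [hI]
    simp only [map_add, add_apply, map_sub, sub_apply, A.mul_comm (A.st x) x]
    module
  have h4 := congrArg (fun z => (f z).re) h3
  simp only [map_add, map_smul, Complex.add_re, smul_eq_mul, Complex.mul_re, Complex.re_ofNat,
    Complex.im_ofNat, zero_mul, sub_zero] at h1 h2 h4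
  linarith

lemma IsState.norm_sq_le {f : J →L[ℂ] ℂ} (hf : A.IsState f) (x : J) :
    ‖f x‖ ^ 2 ≤ (f (A.mul x (A.st x))).re := by
  have h := hf.re_mul_st_nonneg (x - f x • A.e)
  have h2 : f (A.mul (x - f x • A.e) (A.st (x - f x • A.e))) =
      f (A.mul x (A.st x)) - f x * starRingEnd ℂ (f x) := by
    simp only [A.st_sub, A.st_smul, A.st_e, map_sub, sub_apply, map_smul, smul_apply, A.mul_e,
      A.e_mul, hf.apply_st, hf.2, smul_eq_mul]
    ring
  rw [h2, Complex.mul_conj, Complex.sub_re, Complex.ofReal_re, Complex.normSq_eq_norm_sq] at h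
  linarith

variable (A)

/-- The numerical radius controls the norm. -/
lemma norm_le_of_forall_isState {x : J} {v : ℝ} (hv : 0 < v)
    (h : ∀ f, A.IsState f → ‖f x‖ ≤ v) : ‖x‖ ≤ Real.exp 1 * v := by
  have hnum : ∀ y : J, ∃ F : J →L[ℂ] ℂ, ‖F‖ ≤ 1 ∧ F y = (‖y‖ : ℂ) ∧
      ‖F (A.mul x y)‖ ≤ v * ‖y‖ := by
    intro y
    by_cases hy : y = 0
    · exact ⟨0, by simp, by simp [hy], by simp [hy]⟩
    obtain ⟨F, hF1, hF2⟩ := exists_dual_vector ℂ y (norm_ne_zero_iff.mpr hy)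
    have hpos : 0 < ‖y‖ := norm_pos_iff.mpr hy
    have hst : A.IsState (((‖y‖ : ℂ)⁻¹) • (F ∘L A.mul y)) := by
      refine ⟨opNorm_le_bound _ zero_le_one fun z => ?_, ?_⟩
      · rw [smul_apply, norm_smul, norm_inv, Complex.norm_real, norm_norm, one_mul,
          inv_mul_le_iff₀ hpos]
        refine (F.le_opNorm _).trans ?_
        rw [hF1, one_mul]
        exact A.norm_mul_le y z
      · simp [A.mul_e, hF2, hpos.ne']
    refine ⟨F, hF1.le, by simpa using hF2, ?_⟩
    have h1 := h _ hst
    rw [smul_apply, norm_smul, norm_inv, Complex.norm_real, norm_norm,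
      inv_mul_le_iff₀ hpos, comp_apply, A.mul_comm] at h1
    linarith
  have hexp : ∀ z : ℂ, ‖exp (z • A.mul x) A.e‖ ≤ Real.exp (‖z‖ * v) := by
    intro z
    refine (norm_exp_apply_le_of_numericalRange (z • A.mul x) (v := ‖z‖ * v)
      (fun y => ?_) A.e).trans (mul_le_of_le_one_right (Real.exp_pos _).le A.norm_e_le)
    obtain ⟨F, h1, h2, h3⟩ := hnum y
    refine ⟨F, h1, h2, ?_⟩
    rw [smul_apply, map_smul, norm_smul, mul_assoc]
    gcongr
  have hd := hasDerivAt_exp_smul_apply (A.mul x) A.e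
  have hdiff : Differentiable ℂ fun z : ℂ => exp (z • A.mul x) A.e :=
    fun z => (hd z).differentiableAt
  have hC := Complex.norm_deriv_le_of_forall_mem_sphere_norm_le (c := (0 : ℂ)) (R := v⁻¹)
    (C := Real.exp 1) (inv_pos.mpr hv) hdiff.diffContOnCl (fun z hz => by
      have hz' : ‖z‖ = v⁻¹ := by simpa using hz
      have := hexp z
      rwa [hz', inv_mul_cancel₀ hv.ne'] at this)
  rw [(hd 0).deriv] at hC
  simpa [A.mul_e] using hC

end Complete

end UnitalJBStar

section Growth

open NormedSpace Filter Topology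

/-- A nonpositive function on the right of `0` vanishing at `0` has nonpositive derivative. -/
lemma deriv_nonpos_of_nonpos_right {k : ℝ → ℝ} {k' : ℝ} (hk : HasDerivAt k k' 0) (h0 : k 0 = 0)
    (hle : ∀ x, 0 ≤ x → k x ≤ 0) : k' ≤ 0 := by
  have h : Tendsto (slope k 0) (𝓝[>] 0) (𝓝 k') :=
    (hasDerivAt_iff_tendsto_slope.mp hk).mono_left
      (nhdsWithin_mono 0 (fun z (hz : (0 : ℝ) < z) => hz.ne'))
  refine le_of_tendsto h ?_
  filter_upwards [self_mem_nhdsWithin] with x hx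
  have hx' : (0 : ℝ) < x := hx
  rw [slope_def_field, h0, sub_zero, sub_zero]
  exact div_nonpos_of_nonpos_of_nonneg (hle x hx'.le) hx'.le

/-- An orbit whose exponential growth rate is at most `δ` on the positive axis and which is bounded
on the imaginary axis has velocity at most `δ` at the origin. -/
lemma re_apply_le_of_growth {E : Type*} [NormedAddCommGroup E] [NormedSpace ℂ E] [CompleteSpace E]
    (S : E →L[ℂ] E) (x : E) (f : E →L[ℂ] ℂ) (hfx : f x = 1) {K δ : ℝ}
    (hre : ∀ t : ℝ, 0 ≤ t → ‖f (exp ((t : ℂ) • S) x)‖ ≤ K * Real.exp (δ * t))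
    (him : ∀ t : ℝ, ‖f (exp (((t : ℂ) * Complex.I) • S) x)‖ ≤ 1) : (f (S x)).re ≤ δ := by
  set g : ℂ → ℂ := fun z => Complex.exp (-(δ : ℂ) * z) * f (exp (z • S) x) with hg
  have hdiff : Differentiable ℂ g := by
    intro z
    have h1 : DifferentiableAt ℂ (fun z : ℂ => f (exp (z • S) x)) z :=
      f.differentiableAt.comp z (hasDerivAt_exp_smul_apply S x z).differentiableAt
    have h2 : DifferentiableAt ℂ (fun z : ℂ => Complex.exp (-(δ : ℂ) * z)) z := by fun_prop
    exact h2.mul h1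
  have hnorm : ∀ z : ℂ, ‖g z‖ = Real.exp (-δ * z.re) * ‖f (exp (z • S) x)‖ := by
    intro z
    rw [hg, norm_mul, Complex.norm_exp]
    congr 2
    simp
  have hgrow : ∀ z : ℂ, ‖g z‖ ≤ (‖f‖ * ‖x‖) * Real.exp ((|δ| + ‖S‖) * ‖z‖ ^ (1 : ℝ)) := by
    intro z
    rw [hnorm, Real.rpow_one]
    have h1 : ‖f (exp (z • S) x)‖ ≤ ‖f‖ * (Real.exp (‖z‖ * ‖S‖) * ‖x‖) := by
      refine (f.le_opNorm _).trans ?_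
      gcongr
      refine (ContinuousLinearMap.le_opNorm _ _).trans ?_
      gcongr
      refine (norm_exp_le_exp_norm _).trans ?_
      rw [norm_smul]
    have h2 : Real.exp (-δ * z.re) ≤ Real.exp (|δ| * ‖z‖) := by
      refine Real.exp_le_exp.mpr ?_
      calc -δ * z.re ≤ |-δ * z.re| := le_abs_self _
        _ = |δ| * |z.re| := by rw [abs_mul, abs_neg]
        _ ≤ |δ| * ‖z‖ := by gcongr; exact Complex.abs_re_le_norm z
    calc Real.exp (-δ * z.re) * ‖f (exp (z • S) x)‖
        ≤ Real.exp (|δ| * ‖z‖) * (‖f‖ * (Real.exp (‖z‖ * ‖S‖) * ‖x‖)) := by gcongr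
      _ = (‖f‖ * ‖x‖) * Real.exp ((|δ| + ‖S‖) * ‖z‖) := by
          rw [add_mul, Real.exp_add, mul_comm ‖z‖]
          ring
  have hPL : ∀ t : ℝ, 0 ≤ t → ‖g t‖ ≤ 1 := by
    intro t ht
    refine PhragmenLindelof.right_half_plane_of_bounded_on_real hdiff.diffContOnCl
      ⟨1, by norm_num, |δ| + ‖S‖, ?_⟩ ?_ ?_ (by simpa using ht)
    · refine Asymptotics.IsBigO.of_bound (‖f‖ * ‖x‖) (Eventually.of_forall fun z => ?_)
      rw [Real.norm_of_nonneg (Real.exp_pos _).le]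
      exact hgrow z
    · refine ⟨K, ?_⟩
      rw [eventually_map]
      filter_upwards [eventually_ge_atTop 0] with s hs
      rw [hnorm, Complex.ofReal_re]
      calc Real.exp (-δ * s) * ‖f (exp ((s : ℂ) • S) x)‖
          ≤ Real.exp (-δ * s) * (K * Real.exp (δ * s)) := by gcongr; exact hre s hs
        _ = K := by rw [mul_left_comm, ← Real.exp_add]; simp
    · intro s
      rw [hnorm]
      simpa using him s
  have hder : HasDerivAt (fun t : ℝ => (f (exp ((t : ℂ) • S) x)).re - Real.exp (δ * t))
      ((f (S x)).re - δ) 0 := by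
    have h1 := Complex.reCLM.hasFDerivAt.comp_hasDerivAt (0 : ℝ)
      ((hasDerivAt_exp_ofReal_smul_apply S x 0).complexCLM_comp f)
    have h2 : HasDerivAt (fun t : ℝ => Real.exp (δ * t)) (Real.exp (δ * 0) * (δ * 1)) 0 :=
      ((hasDerivAt_id (0 : ℝ)).const_mul δ).exp
    refine (h1.sub h2).congr_deriv ?_
    simp
  have := deriv_nonpos_of_nonpos_right hder (by simp [hfx]) (fun t ht => by
    have h := hPL t ht
    rw [hnorm, Complex.ofReal_re, neg_mul, Real.exp_neg, inv_mul_le_iff₀ (Real.exp_pos _),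
      mul_one] at h
    exact sub_nonpos.mpr ((Complex.re_le_norm _).trans h))
  linarith

end Growth

namespace UnitalJBStar

open ContinuousLinearMap NormedSpace Filter Topology

variable {J : Type*} [NormedAddCommGroup J] [NormedSpace ℂ J] [CompleteSpace J]
  (A : UnitalJBStar J)

section Bergmann

variable {c : J} {w : ℝ → J}

lemma apply_primitive_eq_zero (hw0 : w 0 = 0)
    (hw : ∀ t : ℝ, HasDerivAt w (-exp ((t : ℂ) • A.D c c) c) t)
    {F : Type*} [NormedAddCommGroup F] [NormedSpace ℂ F] (L : J →L[ℂ] F)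
    (hL : ∀ k : ℕ, L ((A.D c c ^ k) c) = 0) (t : ℝ) : L (w t) = 0 := by
  have hv : ∀ s : ℝ, L (exp ((s : ℂ) • A.D c c) c) = 0 := fun s => by
    simpa using apply_exp_eq_of_forall_pow (S := A.D c c) (R := A.D c c) (x := c) (y := c) L 0
      (by simpa using hL) s
  have hd : ∀ s : ℝ, HasDerivAt (fun s => L (w s)) 0 s := fun s => by
    have h := (hw s).complexCLM_comp L
    rwa [map_neg, hv, neg_zero] at h
  have h := is_const_of_deriv_eq_zero (fun s => (hd s).differentiableAt)
    (fun s => (hd s).deriv) t 0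
  simpa [hw0] using h

lemma D_self_primitive (hw0 : w 0 = 0)
    (hw : ∀ t : ℝ, HasDerivAt w (-exp ((t : ℂ) • A.D c c) c) t) (t : ℝ) :
    A.D c c (w t) = c - exp ((t : ℂ) • A.D c c) c := by
  have hd : ∀ s : ℝ, HasDerivAt
      (fun s : ℝ => A.D c c (w s) + exp ((s : ℂ) • A.D c c) c) 0 s := fun s => by
    have h := ((hw s).complexCLM_comp (A.D c c)).add
      (hasDerivAt_exp_ofReal_smul_apply (A.D c c) c s)
    rwa [map_neg, neg_add_cancel] at h
  have h := is_const_of_deriv_eq_zero (fun s => (hd s).differentiableAt)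
    (fun s => (hd s).deriv) t 0
  simp [hw0] at h
  exact eq_sub_of_add_eq h

lemma D_self_D_primitive (hw0 : w 0 = 0)
    (hw : ∀ t : ℝ, HasDerivAt w (-exp ((t : ℂ) • A.D c c) c) t) (t : ℝ) (z : J) :
    A.D c c (A.D (w t) c z) = A.D (w t) c (A.D c c z) := by
  have h := A.apply_primitive_eq_zero hw0 hw
    (A.D c c ∘L (A.box c).flip z - (A.box c).flip (A.D c c z)) (fun k => by
      simpa [box_apply, sub_eq_zero] using DFunLike.congr_fun (A.commute_D_pow c k).eq z) t
  simpa [box_apply, sub_eq_zero] using h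

lemma D_self_D_quad_primitive (hw0 : w 0 = 0)
    (hw : ∀ t : ℝ, HasDerivAt w (-exp ((t : ℂ) • A.D c c) c) t) (t : ℝ) (z : J) :
    A.D c c (A.D (A.D (w t) c (w t)) c z) = A.D (A.D (w t) c (w t)) c (A.D c c z) := by
  set L : J →L[ℂ] J := A.D c c ∘L (A.box c).flip z - (A.box c).flip (A.D c c z) with hL
  have h1 : ∀ i : ℕ, L (A.D ((A.D c c ^ i) c) c (w t)) = 0 := fun i =>
    A.apply_primitive_eq_zero hw0 hw (L ∘L A.D ((A.D c c ^ i) c) c) (fun k => by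
      have h := A.D_pow_pow_pow c i 0 k
      rw [pow_zero, one_apply_eq_self] at h
      rw [comp_apply, h]
      simpa [hL, box_apply, sub_eq_zero] using
        DFunLike.congr_fun (A.commute_D_pow c (i + 0 + k + 1)).eq z) t
  have h2 := A.apply_primitive_eq_zero hw0 hw (L ∘L (A.box c).flip (w t)) (fun i => by
    simpa [box_apply] using h1 i) t
  simpa [hL, box_apply, sub_eq_zero] using h2

lemma two_smul_D_self_D_primitive_e (hw0 : w 0 = 0)
    (hw : ∀ t : ℝ, HasDerivAt w (-exp ((t : ℂ) • A.D c c) c) t) (t : ℝ) :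
    (2 : ℂ) • A.D c c (A.D (w t) c A.e) =
      A.D (A.D c c (w t)) c A.e + A.D c (A.D c A.e c) (w t) := by
  have h := A.D_mid_quad c c A.e (w t)
  rw [← A.D_self_D_primitive hw0 hw] at h
  linear_combination (norm := module) -h

lemma D_self_D_D_primitive (hw0 : w 0 = 0)
    (hw : ∀ t : ℝ, HasDerivAt w (-exp ((t : ℂ) • A.D c c) c) t) (t : ℝ) :
    A.D c c (A.D (w t) (A.D c A.e c) (w t)) =
      A.D (A.D c c (w t)) (A.D c A.e c) (w t) := by
  have hP : ∀ z, A.D (w t) (A.D c z c) (w t) =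
      (2 : ℂ) • A.D (w t) c (A.D (w t) c z) - A.D (A.D (w t) c (w t)) c z := fun z => by
    linear_combination (norm := module) A.D_mid_quad (w t) c z (w t)
  have h1 : A.D c c (A.D (w t) (A.D c A.e c) (w t)) =
      A.D (w t) (A.D c c (A.D c A.e c)) (w t) := by
    rw [A.D_apply_quad c c A.e, hP, hP, map_sub, map_smul, A.D_self_D_primitive hw0 hw,
      A.D_self_D_primitive hw0 hw, A.D_self_D_quad_primitive hw0 hw]
  have h2 := A.D_D c c (w t) (A.D c A.e c) (w t)
  rw [A.D_symm (w t) _ (A.D c c (w t))] at h2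
  linear_combination (norm := module) (1 / 2 : ℂ) • h2 + (1 / 2 : ℂ) • h1

/-- The orbit of the unit under the flow of `D c c` is given by a Bergmann operator. -/
lemma exp_two_D_self_e (hw0 : w 0 = 0)
    (hw : ∀ t : ℝ, HasDerivAt w (-exp ((t : ℂ) • A.D c c) c) t) (t : ℝ) :
    exp ((t : ℂ) • ((2 : ℂ) • A.D c c)) A.e =
      A.e - (2 : ℂ) • A.D (w t) c A.e + A.D (w t) (A.D c A.e c) (w t) := by
  set m := A.D c A.e c with hm
  set G : ℝ → J := fun t => A.e - (2 : ℂ) • A.D (w t) c A.e + A.D (w t) m (w t) with hG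
  have hder : ∀ s, HasDerivAt G (((2 : ℂ) • A.D c c) (G s)) s := by
    intro s
    have hv : HasDerivAt w (A.D c c (w s) - c) s := by
      have h := hw s
      rwa [← sub_sub_cancel c (exp ((s : ℂ) • A.D c c) c), ← A.D_self_primitive hw0 hw,
        neg_sub] at h
    have h1 := A.hasDerivAt_D hv (hasDerivAt_const s c) (hasDerivAt_const s A.e)
    have h2 := A.hasDerivAt_D hv (hasDerivAt_const s m) hv
    have h3 := ((h1.complexCLM_comp ((2 : ℂ) • ContinuousLinearMap.id ℂ J)).const_sub A.e).add h2
    refine h3.congr_deriv ?_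
    have e1 := A.two_smul_D_self_D_primitive_e hw0 hw s
    have e2 := A.D_self_D_D_primitive hw0 hw s
    rw [← hm] at e1 e2
    simp only [hG, smul_apply, map_add, map_sub, map_smul, id_apply, D_sub, sub_apply, D_zero_mid,
      zero_apply, map_zero, add_zero]
    rw [e1, e2, A.D_symm (w s) m (A.D c c (w s)), A.D_symm (w s) m c]
    module
  have h := eq_exp_apply_of_hasDerivAt _ hder t
  have h0 : G 0 = A.e := by simp [hG, hw0, D_zero]
  rw [h0] at h
  exact h.symm

end Bergmann

lemma exists_primitive (c : J) : ∃ w : ℝ → J, w 0 = 0 ∧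
    ∀ t : ℝ, HasDerivAt w (-exp ((t : ℂ) • A.D c c) c) t := by
  have hcont : Continuous fun t : ℝ => -exp ((t : ℂ) • A.D c c) c :=
    continuous_iff_continuousAt.mpr fun t =>
      (hasDerivAt_exp_ofReal_smul_apply (A.D c c) c t).neg.continuousAt
  exact ⟨fun t => ∫ s in (0 : ℝ)..t, -exp ((s : ℂ) • A.D c c) c, by simp, fun t =>
    intervalIntegral.integral_hasDerivAt_right (hcont.intervalIntegrable _ _)
      (hcont.stronglyMeasurableAtFilter _ _) hcont.continuousAt⟩

/-- If the orbit of `c` under the flow of `D c c` grows slowly, then `c` is small. -/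
lemma norm_le_of_orbit_growth {c : J} {C ε : ℝ} (hε : 0 < ε)
    (h : ∀ s : ℝ, 0 ≤ s → ‖exp ((s : ℂ) • A.D c c) c‖ ≤ C * Real.exp (ε * s)) :
    ‖c‖ ≤ Real.exp 1 * √ε := by
  obtain ⟨w, hw0, hw⟩ := A.exists_primitive c
  have hC : 0 ≤ C := by
    have h0 := (norm_nonneg _).trans (h 0 le_rfl)
    simpa using h0
  have hwb : ∀ t, 0 ≤ t → ‖w t‖ ≤ C / ε * Real.exp (ε * t) := by
    intro t ht
    refine image_norm_le_of_norm_deriv_right_le_deriv_boundary (a := 0) (b := t)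
      (f' := fun t => -exp ((t : ℂ) • A.D c c) c) (B := fun t => C / ε * Real.exp (ε * t))
      (B' := fun t => C * Real.exp (ε * t))
      (fun s _ => (hw s).continuousAt.continuousWithinAt) (fun s _ => (hw s).hasDerivWithinAt)
      ?_ (fun s => ?_) (fun s hs => ?_) ⟨ht, le_rfl⟩
    · rw [hw0, norm_zero]
      positivity
    · have h2 : HasDerivAt (fun t : ℝ => C / ε * Real.exp (ε * t))
        (C / ε * (Real.exp (ε * s) * (ε * 1))) s :=
        (((hasDerivAt_id s).const_mul ε).exp).const_mul _
      refine h2.congr_deriv ?_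
      field_simp
    · rw [norm_neg]
      exact h s hs.1
  refine A.norm_le_of_forall_isState (Real.sqrt_pos.mpr hε) fun f hf => ?_
  refine Real.le_sqrt_of_sq_le ((hf.norm_sq_le c).trans ?_)
  set m := A.D c A.e c with hm
  have hgr := re_apply_le_of_growth ((2 : ℂ) • A.D c c) A.e f hf.2
    (K := 1 + 6 * (C / ε) * ‖c‖ + 3 * (C / ε) ^ 2 * ‖m‖) (δ := 2 * ε) (fun t ht => ?_)
    (fun t => ?_)
  · simp only [smul_apply, map_smul, smul_eq_mul, Complex.mul_re, Complex.re_ofNat,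
      Complex.im_ofNat, zero_mul, sub_zero, D_e_right] at hgr
    linarith
  · refine (hf.norm_apply_le _).trans ?_
    rw [A.exp_two_D_self_e hw0 hw, ← hm]
    set E := Real.exp (ε * t) with hE
    have hE1 : 1 ≤ E := Real.one_le_exp (by positivity)
    have hE2 : Real.exp (2 * ε * t) = E ^ 2 := by
      rw [hE, ← Real.exp_nat_mul]
      congr 1
      push_cast
      ring
    have hw' := hwb t ht
    rw [← hE] at hw'
    have hb : 0 ≤ C / ε := by positivity
    have h1 : ‖A.D (w t) c A.e‖ ≤ 3 * (C / ε) * ‖c‖ * E ^ 2 := by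
      refine (A.norm_D_apply_le _ _ _).trans ?_
      calc 3 * ‖w t‖ * ‖c‖ * ‖A.e‖ ≤ 3 * (C / ε * E) * ‖c‖ * 1 := by
            gcongr
            exact A.norm_e_le
        _ ≤ 3 * (C / ε * E) * ‖c‖ * E := by gcongr
        _ = _ := by ring
    have h2 : ‖A.D (w t) m (w t)‖ ≤ 3 * (C / ε) ^ 2 * ‖m‖ * E ^ 2 := by
      refine (A.norm_D_apply_le _ _ _).trans ?_
      calc 3 * ‖w t‖ * ‖m‖ * ‖w t‖ ≤ 3 * (C / ε * E) * ‖m‖ * (C / ε * E) := by gcongr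
        _ = _ := by ring
    have h3 : ‖A.e‖ ≤ E ^ 2 := A.norm_e_le.trans (one_le_pow₀ hE1)
    rw [hE2]
    calc _ ≤ ‖A.e - (2 : ℂ) • A.D (w t) c A.e‖ + ‖A.D (w t) m (w t)‖ := norm_add_le _ _
      _ ≤ ‖A.e‖ + ‖(2 : ℂ) • A.D (w t) c A.e‖ + ‖A.D (w t) m (w t)‖ := by
          gcongr
          exact norm_sub_le _ _
      _ ≤ _ := by
          rw [norm_smul, Complex.norm_ofNat]
          linarith
  · refine (hf.norm_apply_le _).trans ((le_opNorm _ _).trans ?_)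
    have h := A.norm_exp_I_smul_D_le c (2 * t)
    rw [smul_smul]
    push_cast at h
    rw [show (t : ℂ) * Complex.I * 2 = 2 * t * Complex.I by ring]
    exact mul_le_one₀ h (norm_nonneg _) A.norm_e_le

end UnitalJBStar

section SpectralGrowth

open NormedSpace Filter Topology

lemma im_eq_zero_of_norm_exp_le {z : ℂ} {K : ℝ}
    (h : ∀ τ : ℝ, ‖Complex.exp ((τ : ℂ) * Complex.I * z)‖ ≤ K) : z.im = 0 := by
  by_contra hz
  have h1 := h (-K / z.im)
  rw [Complex.norm_exp] at h1
  have h2 : (((-K / z.im : ℝ) : ℂ) * Complex.I * z).re = K := by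
    simp only [Complex.mul_re, Complex.mul_im, Complex.ofReal_re, Complex.ofReal_im, Complex.I_re,
      Complex.I_im]
    field_simp
    ring
  rw [h2] at h1
  linarith [Real.add_one_le_exp K]

lemma norm_exp_mul_exp_neg_sq_le {z : ℂ} (hz : z.im = 0) {t : ℝ} (ht : 0 < t) :
    ‖Complex.exp (z * Complex.exp (-(t : ℂ) * z) ^ 2)‖ ≤ Real.exp (1 / (2 * t)) := by
  obtain ⟨r, rfl⟩ : ∃ r : ℝ, z = r := ⟨z.re, Complex.ext rfl (by simp [hz])⟩
  rw [Complex.norm_exp, Real.exp_le_exp]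
  have h1 : ((r : ℂ) * Complex.exp (-(t : ℂ) * r) ^ 2).re = r * Real.exp (-t * r) ^ 2 := by
    rw [← Complex.ofReal_re (r * Real.exp (-t * r) ^ 2)]
    push_cast
    rfl
  rw [h1, ← Real.exp_nat_mul, show ((2 : ℕ) : ℝ) * (-t * r) = -(2 * t * r) by push_cast; ring,
    Real.exp_neg, ← div_eq_mul_inv, div_le_div_iff₀ (Real.exp_pos _) (by positivity)]
  linarith [Real.add_one_le_exp (2 * t * r)]

/-- If `x` generates a bounded one-parameter group `exp (i τ x)`, its spectrum is real, and the
spectral radius of `exp (x exp (-2 t x))` is less than `exp (1 / t)`. -/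
lemma eventually_norm_exp_pow_le {B : Type*} [NormedCommRing B] [NormedAlgebra ℂ B]
    [CompleteSpace B] {x : B} {K : ℝ} (hx : ∀ τ : ℝ, ‖exp (((τ : ℂ) * Complex.I) • x)‖ ≤ K)
    {t : ℝ} (ht : 0 < t) :
    ∀ᶠ n : ℕ in atTop, ‖exp (x * exp (-(t : ℂ) • x) ^ 2) ^ n‖ ≤ Real.exp (1 / t) ^ n := by
  let _ : NormedAlgebra ℚ B := NormedAlgebra.restrictScalars ℚ ℂ _
  set R := x * exp (-(t : ℂ) • x) ^ 2 with hR
  have hexp (χ : WeakDual.characterSpace ℂ B) (y : B) : χ (exp y) = Complex.exp (χ y) := by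
    rw [Complex.exp_eq_exp_ℂ]
    exact map_exp χ (map_continuous χ) y
  have hrad : spectralRadius ℂ (exp R) ≤ ENNReal.ofReal (Real.exp (1 / (2 * t))) := by
    refine iSup₂_le fun z hz => ?_
    obtain ⟨χ, rfl⟩ := WeakDual.CharacterSpace.mem_spectrum_iff_exists.mp hz
    have him : (χ x).im = 0 := by
      refine im_eq_zero_of_norm_exp_le (K := ‖WeakDual.toStrongDual (χ : WeakDual ℂ B)‖ * K)
        fun τ => ?_
      have h1 := hexp χ (((τ : ℂ) * Complex.I) • x)
      rw [map_smul, smul_eq_mul] at h1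
      rw [← h1]
      refine ((WeakDual.toStrongDual (χ : WeakDual ℂ B)).le_opNorm _).trans ?_
      gcongr
      exact hx τ
    rw [← ENNReal.ofReal_coe_nnreal, coe_nnnorm]
    refine ENNReal.ofReal_le_ofReal ?_
    rw [hexp, hR, map_mul, map_pow, hexp, map_smul, smul_eq_mul]
    exact norm_exp_mul_exp_neg_sq_le him ht
  have hlt : spectralRadius ℂ (exp R) < ENNReal.ofReal (Real.exp (1 / t)) := by
    refine hrad.trans_lt ((ENNReal.ofReal_lt_ofReal_iff (Real.exp_pos _)).mpr ?_)
    rw [Real.exp_lt_exp]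
    exact one_div_lt_one_div_of_lt ht (by linarith)
  filter_upwards [(spectrum.pow_norm_pow_one_div_tendsto_nhds_spectralRadius (exp R)).eventually
    (gt_mem_nhds hlt), eventually_gt_atTop 0] with n hn hn0
  have h1 := ((ENNReal.ofReal_lt_ofReal_iff (Real.exp_pos _)).mp hn).le
  calc ‖exp R ^ n‖ = (‖exp R ^ n‖ ^ (1 / n : ℝ)) ^ n := by
        rw [one_div, Real.rpow_inv_natCast_pow (norm_nonneg _) hn0.ne']
    _ ≤ _ := by gcongr

lemma eventually_norm_exp_pow_le_of_isometry {A B : Type*} [NormedRing A] [NormedAlgebra ℂ A]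
    [NormedRing B] [NormedAlgebra ℂ B] [CompleteSpace B] (hcomm : ∀ x y : B, x * y = y * x)
    (φ : B →ₐ[ℂ] A) (hφ : Isometry φ) {x : B} {K : ℝ}
    (hx : ∀ τ : ℝ, ‖exp (((τ : ℂ) * Complex.I) • φ x)‖ ≤ K) {t : ℝ} (ht : 0 < t) :
    ∀ᶠ n : ℕ in atTop, ‖exp (φ x * exp (-(t : ℂ) • φ x) ^ 2) ^ n‖ ≤ Real.exp (1 / t) ^ n := by
  let _ : NormedAlgebra ℚ A := NormedAlgebra.restrictScalars ℚ ℂ _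
  let _ : NormedAlgebra ℚ B := NormedAlgebra.restrictScalars ℚ ℂ _
  have hn (z : B) : ‖φ z‖ = ‖z‖ := hφ.norm_map_of_map_zero (map_zero φ) z
  let inst : NormedCommRing B := { ‹NormedRing B› with mul_comm := hcomm }
  have h := @eventually_norm_exp_pow_le B inst ‹_› ‹_› x K (fun τ => ?_) t ht
  · filter_upwards [h] with n hn'
    refine le_of_eq_of_le ?_ hn'
    rw [← hn, map_pow, map_exp φ hφ.continuous, map_mul, map_pow, map_exp φ hφ.continuous,
      map_smul]
  · rw [← hn, map_exp φ hφ.continuous, map_smul]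
    exact hx τ

/-- The exponential growth rate along `x exp (-2 t x)` is at most `1 / t` when `x` generates a
bounded one-parameter group `exp (i τ x)`. -/
lemma exists_norm_exp_le {E : Type*} [NormedAddCommGroup E] [NormedSpace ℂ E] [CompleteSpace E]
    {x : E →L[ℂ] E} {K : ℝ} (hx : ∀ τ : ℝ, ‖exp (((τ : ℂ) * Complex.I) • x)‖ ≤ K)
    {t : ℝ} (ht : 0 < t) :
    ∃ C : ℝ, ∀ s : ℝ, 0 ≤ s →
      ‖exp ((s : ℂ) • (x * exp (-(t : ℂ) • x) ^ 2))‖ ≤ C * Real.exp (1 / t * s) := by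
  let _ : NormedAlgebra ℚ (E →L[ℂ] E) := NormedAlgebra.restrictScalars ℚ ℂ _
  set R := x * exp (-(t : ℂ) • x) ^ 2 with hR
  have hev : ∀ᶠ n : ℕ in atTop, ‖exp R ^ n‖ ≤ Real.exp (1 / t) ^ n :=
    eventually_norm_exp_pow_le_of_isometry (mul_comm (G := Algebra.elemental ℂ x))
      (Algebra.elemental ℂ x).val isometry_subtype_coe
      (x := ⟨x, Algebra.elemental.self_mem ℂ x⟩) hx ht
  obtain ⟨N, hN⟩ := eventually_atTop.mp hev
  set M := ∑ n ∈ Finset.range N, ‖exp R ^ n‖ with hM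
  have hM0 : 0 ≤ M := Finset.sum_nonneg fun _ _ => norm_nonneg _
  have hE : 1 ≤ Real.exp (1 / t) := Real.one_le_exp (by positivity)
  have hall (n : ℕ) : ‖exp R ^ n‖ ≤ (M + 1) * Real.exp (1 / t) ^ n := by
    have h1 : 1 ≤ Real.exp (1 / t) ^ n := one_le_pow₀ hE
    rcases lt_or_ge n N with h | h
    · have h2 : ‖exp R ^ n‖ ≤ M :=
        Finset.single_le_sum (f := fun n => ‖exp R ^ n‖) (fun _ _ => norm_nonneg _)
          (Finset.mem_range.mpr h)
      nlinarith
    · have h2 := hN n h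
      nlinarith
  refine ⟨(M + 1) * Real.exp ‖R‖, fun s hs => ?_⟩
  set n := ⌊s⌋₊
  have hn : (n : ℝ) ≤ s := Nat.floor_le hs
  have hn' : s - n ≤ 1 := by linarith [Nat.lt_floor_add_one s]
  have hsplit : exp ((s : ℂ) • R) = exp R ^ n * exp (((s - n : ℝ) : ℂ) • R) := by
    rw [← exp_nsmul, ← exp_add_of_commute (((Commute.refl R).smul_left n).smul_right _),
      ← Nat.cast_smul_eq_nsmul ℂ, ← add_smul]
    congr 2
    push_cast
    ring
  have h2 : ‖exp (((s - n : ℝ) : ℂ) • R)‖ ≤ Real.exp ‖R‖ := by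
    refine (norm_exp_le_exp_norm _).trans (Real.exp_le_exp.mpr ?_)
    rw [norm_smul, Complex.norm_real, Real.norm_of_nonneg (by linarith)]
    exact mul_le_of_le_one_left (norm_nonneg _) hn'
  have h3 : Real.exp (1 / t) ^ n ≤ Real.exp (1 / t * s) := by
    rw [← Real.exp_nat_mul, Real.exp_le_exp, mul_comm]
    gcongr
  rw [hsplit]
  calc _ ≤ ‖exp R ^ n‖ * ‖exp (((s - n : ℝ) : ℂ) • R)‖ := norm_mul_le _ _
    _ ≤ (M + 1) * Real.exp (1 / t * s) * Real.exp ‖R‖ := by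
        gcongr
        exact (hall n).trans (by gcongr)
    _ = _ := by ring

end SpectralGrowth

open NormedSpace in
/-- A real-linear version of `apply_exp_eq_of_forall_pow`. -/
lemma apply_exp_ofReal_eq_of_forall_pow {E F : Type*} [NormedAddCommGroup E] [NormedSpace ℂ E]
    [NormedAddCommGroup F] [NormedSpace ℂ F] [CompleteSpace E] {S : E →L[ℂ] E} {x : E}
    (L L' : E →L[ℝ] F) (h : ∀ k : ℕ, L ((S ^ k) x) = L' ((S ^ k) x)) (t : ℝ) :
    L (exp ((t : ℂ) • S) x) = L' (exp ((t : ℂ) • S) x) := by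
  have key : ∀ M : E →L[ℝ] F,
      HasSum (fun k : ℕ => ((k.factorial : ℝ)⁻¹ * t ^ k) • M ((S ^ k) x))
        (M (exp ((t : ℂ) • S) x)) := by
    intro M
    have h1 := exp_series_hasSum_exp' (𝕂 := ℂ) ((t : ℂ) • S)
    have h2 := M.hasSum (((ContinuousLinearMap.apply ℂ E x).hasSum h1))
    convert h2 using 2 with k
    · rw [← map_smul, ← Complex.coe_smul]
      simp [smul_pow, mul_smul, -Complex.ofReal_pow]
    · rfl
  refine (key L).unique ?_
  simp only [h]
  exact key L'

namespace UnitalJBStar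

open ContinuousLinearMap NormedSpace Filter Topology

variable {J : Type*} [NormedAddCommGroup J] [NormedSpace ℂ J] (A : UnitalJBStar J)

/-- The triple product as a real-linear map of its middle variable. -/
noncomputable def midCLM (x z : J) : J →L[ℝ] J :=
  ((A.mul.flip z ∘L A.mul x + A.mul.flip x ∘L A.mul z - A.mul (A.mul x z)).restrictScalars ℝ) ∘L
    A.stCLM

lemma midCLM_apply (x y z : J) : A.midCLM x z y = A.D x y z := by
  rw [D_apply]
  rfl

variable [CompleteSpace J] (a : J)

lemma D_pow_exp_pow (i k : ℕ) (t : ℝ) :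
    A.D ((A.D a a ^ i) a) (exp ((t : ℂ) • A.D a a) a) ((A.D a a ^ k) a) =
      (A.D a a ^ (i + k + 1)) (exp ((t : ℂ) • A.D a a) a) := by
  have h := apply_exp_ofReal_eq_of_forall_pow (S := A.D a a) (x := a)
    (A.midCLM ((A.D a a ^ i) a) ((A.D a a ^ k) a))
    ((A.D a a ^ (i + k + 1)).restrictScalars ℝ) (fun j => ?_) t
  · rwa [midCLM_apply] at h
  · rw [midCLM_apply, D_pow_pow_pow, coe_restrictScalars', ← mul_apply_eq_comp, ← pow_add]
    congr 2
    ring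

lemma D_exp_exp_pow (k : ℕ) (t : ℝ) :
    A.D (exp ((t : ℂ) • A.D a a) a) (exp ((t : ℂ) • A.D a a) a) ((A.D a a ^ k) a) =
      (A.D a a * exp ((t : ℂ) • A.D a a) ^ 2) ((A.D a a ^ k) a) := by
  set E := exp ((t : ℂ) • A.D a a) with hE
  have hc : Commute (A.D a a) E := ((Commute.refl (A.D a a)).smul_right (t : ℂ)).exp_right
  rw [D_symm]
  have h := apply_exp_eq_of_forall_pow (S := A.D a a) (R := A.D a a) (x := a) (y := a)
    (A.D ((A.D a a ^ k) a) (E a)) (A.D a a ^ (k + 1) * E) (fun j => ?_) t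
  · rw [h, ← hE, ← mul_apply_eq_comp, ← mul_apply_eq_comp, mul_assoc, mul_assoc, ← sq, pow_succ',
      mul_assoc, (hc.pow_left k).pow_right 2]
  · rw [hE, D_pow_exp_pow, ← hE, ← mul_apply_eq_comp, ← mul_apply_eq_comp, mul_assoc,
      ← (hc.pow_left j).eq, ← mul_assoc, ← pow_add]
    congr 3
    ring

lemma D_exp_self_pow_apply (k : ℕ) (t : ℝ) :
    (A.D (exp ((t : ℂ) • A.D a a) a) (exp ((t : ℂ) • A.D a a) a) ^ k)
        (exp ((t : ℂ) • A.D a a) a) =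
      ((A.D a a * exp ((t : ℂ) • A.D a a) ^ 2) ^ k) (exp ((t : ℂ) • A.D a a) a) := by
  let _ : NormedAlgebra ℚ (J →L[ℂ] J) := NormedAlgebra.restrictScalars ℚ ℂ _
  set E := exp ((t : ℂ) • A.D a a) with hE
  set T := A.D (E a) (E a)
  have hc : Commute (A.D a a) E := ((Commute.refl (A.D a a)).smul_right (t : ℂ)).exp_right
  induction k with
  | zero => rfl
  | succ k ih =>
    have hk : (A.D a a * E ^ 2) ^ k * E =
        A.D a a ^ k * exp ((((2 * k + 1 : ℕ) : ℂ) * t) • A.D a a) := by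
      rw [(hc.pow_right 2).mul_pow, ← pow_mul, mul_assoc, ← pow_succ, mul_smul,
        Nat.cast_smul_eq_nsmul, exp_nsmul]
    have h := apply_exp_eq_of_forall_pow (S := A.D a a) (R := A.D a a) (x := a) (y := a)
      (T * A.D a a ^ k) (A.D a a * E ^ 2 * A.D a a ^ k) (fun j => ?_)
      (((2 * k + 1 : ℕ) : ℂ) * t)
    · rw [pow_succ', mul_apply_eq_comp, ih, ← mul_apply_eq_comp _ E, hk, mul_apply_eq_comp,
        ← mul_apply_eq_comp T, h, mul_apply_eq_comp, ← mul_apply_eq_comp (A.D a a ^ k), ← hk,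
        ← mul_apply_eq_comp, ← mul_assoc, ← pow_succ']
      rfl
    · rw [mul_apply_eq_comp, mul_apply_eq_comp _ (A.D a a ^ k), ← mul_apply_eq_comp (A.D a a ^ k),
        ← pow_add]
      exact A.D_exp_exp_pow a (k + j) t

/-- The orbit of `a` under the flow `exp (-t D(a, a))` decays like `t ^ (-1 / 2)`. -/
lemma norm_exp_neg_D_self_le {t : ℝ} (ht : 0 < t) :
    ‖exp (-(t : ℂ) • A.D a a) a‖ ≤ Real.exp 1 * √(1 / t) := by
  obtain ⟨C, hC⟩ := exists_norm_exp_le (x := A.D a a) (A.norm_exp_I_smul_D_le a) ht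
  refine A.norm_le_of_orbit_growth (C := C * ‖exp (-(t : ℂ) • A.D a a) a‖) (by positivity)
    fun s hs => ?_
  have h := apply_exp_eq_of_forall_pow (ContinuousLinearMap.id ℂ J) (ContinuousLinearMap.id ℂ J)
    (A.D_exp_self_pow_apply a · (-t)) s
  rw [Complex.ofReal_neg] at h
  calc _ = ‖exp ((s : ℂ) • (A.D a a * exp (-(t : ℂ) • A.D a a) ^ 2))
          (exp (-(t : ℂ) • A.D a a) a)‖ := congrArg norm h
    _ ≤ C * Real.exp (1 / t * s) * ‖exp (-(t : ℂ) • A.D a a) a‖ :=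
        (le_opNorm _ _).trans (by gcongr; exact hC s hs)
    _ = _ := by ring

lemma tendsto_exp_neg_D_self :
    Tendsto (fun t : ℝ => exp ((t : ℂ) • (-A.D a a)) a) atTop (𝓝 0) := by
  refine squeeze_zero_norm' (a := fun t => Real.exp 1 * √(1 / t)) ?_ ?_
  · filter_upwards [eventually_gt_atTop 0] with t ht
    rw [smul_neg, ← neg_smul]
    exact A.norm_exp_neg_D_self_le a ht
  · have h : Tendsto (fun t : ℝ => 1 / t) atTop (𝓝 0) := by
      simpa only [one_div] using tendsto_inv_atTop_zero
    simpa using (h.sqrt).const_mul (Real.exp 1)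

variable {a} {b : J}

lemma D_apply_self_eq_zero (hb : A.D a a b = 0) : A.D a b a = 0 := by
  set c : ℝ → J := fun t => exp ((t : ℂ) • (-A.D a a)) a
  have hc0 : c 0 = a := by simp [c]
  have hu : A.D a a (A.D a b a) = 0 := by rw [D_apply_quad, hb, D_zero_mid, zero_apply]
  have hconst : ∀ t, A.D (c t) b (c t) = A.D a b a := by
    intro t
    have h1 := eq_exp_apply_of_hasDerivAt (-A.D a a) (f := fun _ => A.D a b a)
      (fun s => by simpa [hu] using hasDerivAt_const s (A.D a b a)) t
    have h2 := eq_exp_apply_of_hasDerivAt (-A.D a a) (f := fun t => A.D (c t) b (c t))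
      (fun s => ?_) t
    · simp only [hc0] at h2
      rw [h2, ← h1]
    · have hc := hasDerivAt_exp_ofReal_smul_apply (-A.D a a) a s
      refine (A.hasDerivAt_D hc (hasDerivAt_const s b) hc).congr_deriv ?_
      simp only [neg_apply, D_neg, D_zero_mid, zero_apply, map_neg, c,
        A.commutator_D a _ b _ hb]
      abel
  have hlim : Tendsto (fun t => A.D (c t) b (c t)) atTop (𝓝 (A.D 0 b 0)) :=
    ((A.continuous_D_apply continuous_id continuous_const continuous_id).tendsto 0).comp
      (A.tendsto_exp_neg_D_self a)
  simp only [hconst, map_zero] at hlim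
  exact tendsto_nhds_unique tendsto_const_nhds hlim

/-- In a unital JB*-algebra, `{a, a, b} = 0` implies that `a` and `b` are orthogonal. -/
theorem D_eq_zero (hb : A.D a a b = 0) : A.D a b = 0 := by
  have hpow : ∀ k : ℕ, A.D ((A.D a a ^ (k + 1)) a) b = 0 := by
    intro k
    induction k with
    | zero =>
      ext w
      have h := A.D_quad_add a a b w
      rw [hb, A.D_apply_self_eq_zero hb] at h
      simpa [D_zero, D_zero_mid] using h
    | succ k ih =>
      ext w
      have h := A.commutator_D a ((A.D a a ^ (k + 1)) a) b w hb
      rw [ih] at h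
      rw [pow_succ', mul_apply_eq_comp]
      simpa using h.symm
  set c : ℝ → J := fun t => exp ((t : ℂ) • (-A.D a a)) a
  have hder : ∀ t, HasDerivAt (fun t => A.D (c t) b) 0 t := by
    intro t
    have h := (hasDerivAt_exp_ofReal_smul_apply (-A.D a a) a t).complexCLM_comp (A.box b)
    refine h.congr_deriv ?_
    have h0 := apply_exp_eq_of_forall_pow (S := A.D a a) (R := A.D a a) (x := a) (y := a)
      (A.box b ∘L A.D a a) 0 (fun k => ?_) (-t)
    · rw [neg_apply, map_neg, neg_eq_zero, smul_neg, ← neg_smul]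
      exact h0
    · have hk := hpow k
      rwa [pow_succ', mul_apply_eq_comp] at hk
  have hconst : ∀ t, A.D (c t) b = A.D a b := by
    intro t
    have h := is_const_of_deriv_eq_zero (fun s => (hder s).differentiableAt)
      (fun s => (hder s).deriv) t 0
    simpa [c] using h
  have hlim : Tendsto (fun t => A.D (c t) b) atTop (𝓝 (A.D 0 b)) :=
    ((A.box b).continuous.tendsto 0).comp (A.tendsto_exp_neg_D_self a)
  simp only [hconst, D_zero] at hlim
  exact tendsto_nhds_unique tendsto_const_nhds hlim

end UnitalJBStar

/-- in a unital JB*-algebra, a ⊥ b (i.e. {a,b,c} = 0 for all c) implies a∘b* = 0 and (a∘a*)∘b = (a∘b)∘a*; conversely these two identities imply a ⊥ b. -/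
theorem stmt6
    {J : Type*} [NormedAddCommGroup J] [NormedSpace ℂ J] [CompleteSpace J]
    (jmul : J →L[ℂ] J →L[ℂ] J)
    (hcomm : ∀ a b : J, jmul a b = jmul b a)
    (hjordan : ∀ a b : J, jmul (jmul a b) (jmul a a) = jmul a (jmul b (jmul a a)))
    (hnorm : ∀ a b : J, ‖jmul a b‖ ≤ ‖a‖ * ‖b‖)
    (st : J → J)
    (hst_inv : ∀ a : J, st (st a) = a)
    (hst_add : ∀ a b : J, st (a + b) = st a + st b)
    (hst_smul : ∀ (r : ℂ) (a : J), st (r • a) = (starRingEnd ℂ r) • st a)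
    (hst_mul : ∀ a b : J, st (jmul a b) = jmul (st a) (st b))
    (hst_norm : ∀ a : J, ‖st a‖ = ‖a‖)
    (hcstar : ∀ a : J,
      ‖jmul (jmul a (st a)) a + jmul (jmul a (st a)) a - jmul (jmul a a) (st a)‖ = ‖a‖ ^ 3)
    (e : J) (he : ∀ a : J, jmul e a = a)
    (a b : J) :
    ((∀ c : J, tp jmul st a b c = 0) →
      jmul a (st b) = 0 ∧ jmul (jmul a (st a)) b = jmul (jmul a b) (st a)) ∧
    ((jmul a (st b) = 0 ∧ jmul (jmul a (st a)) b = jmul (jmul a b) (st a)) →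
      ∀ c : J, tp jmul st a b c = 0) := by
  let A : UnitalJBStar J := ⟨jmul, hcomm, hjordan, hnorm, st, hst_inv, hst_add, hst_smul, hst_mul,
    hst_norm, hcstar, e, he⟩
  have hst0 : st 0 = 0 := A.st_zero
  refine ⟨fun h => ?_, fun ⟨h1, h2⟩ => ?_⟩
  · have h0 : jmul a (st b) = 0 := by
      have h := h e
      rwa [tp, hcomm _ e, he, he, hcomm (st b) a, hcomm a e, he, add_sub_cancel_right] at h
    refine ⟨h0, ?_⟩
    have h1 := h (st a)
    rw [tp, h0, map_zero, zero_apply, zero_add, sub_eq_zero] at h1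
    have h2 := congrArg st h1
    simp only [hst_mul, hst_inv] at h2
    rw [h2, hcomm a (st a)]
  · have hba : jmul b (st a) = 0 := by
      have h := congrArg st h1
      rwa [hst_mul, hst_inv, hcomm, hst0] at h
    have hD : A.D a a b = 0 := by
      rw [A.D_apply]
      change jmul (jmul a (st a)) b + jmul (jmul b (st a)) a - jmul (jmul a b) (st a) = 0
      rw [hba, h2, map_zero, zero_apply, add_zero, sub_self]
    intro c
    have h := congrArg (· c) (A.D_eq_zero hD)
    simp only [A.D_apply] at h
    exact h
end

section
/- Let J be a unital JB*-algebra and suppose a, b ∈ J satisfy a∘b* = 0 and (a∘a*)∘b = (a∘b)∘a* (i.e., a ⊥ b). Then for every c ∈ J, (c∘b*)∘a = (a∘c)∘b*; that is, a and b* operator commute. -/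
/-- `IsJBTriple D` says that `(x, y, z) ↦ D x y z` is a Jordan triple product on a complex normed
space which is bounded and satisfies `‖{x,x,x}‖ = ‖x‖ ^ 3`. -/
structure IsJBTriple {J : Type*} [NormedAddCommGroup J] [NormedSpace ℂ J]
    (D : J → J → J →L[ℂ] J) : Prop where
  add_left : ∀ x y z, D (x + y) z = D x z + D y z
  smul_left : ∀ (r : ℂ) x y, D (r • x) y = r • D x y
  add_mid : ∀ x y z, D x (y + z) = D x y + D x z
  smul_mid : ∀ (r : ℂ) x y, D x (r • y) = (starRingEnd ℂ r) • D x y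
  symm : ∀ x y z, D x y z = D z y x
  jordan : ∀ x y u v w,
    D x y (D u v w) = D (D x y u) v w - D u (D y x v) w + D u v (D x y w)
  norm_le : ∀ x y z, ‖D x y z‖ ≤ 3 * ‖x‖ * ‖y‖ * ‖z‖
  norm_cube : ∀ x, ‖D x x x‖ = ‖x‖ ^ 3

/-- A triple as in `IsJBTriple` satisfying a dissipativity condition that encodes the positivity of
the operators `D x x`. -/
structure IsPosTriple {J : Type*} [NormedAddCommGroup J] [NormedSpace ℂ J]
    (D : J → J → J →L[ℂ] J) : Prop extends IsJBTriple D where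
  norm_le_add_cube : ∀ (t : ℝ) x, 0 ≤ t → ‖x‖ ≤ ‖x + (t : ℂ) • D x x x‖

namespace IsJBTriple

variable {J : Type*} [NormedAddCommGroup J] [NormedSpace ℂ J] {D : J → J → J →L[ℂ] J}

theorem zero_left (h : IsJBTriple D) (y : J) : D 0 y = 0 := by
  simpa using h.smul_left 0 0 y

theorem zero_mid (h : IsJBTriple D) (x : J) : D x 0 = 0 := by
  simpa using h.smul_mid 0 x 0

theorem sub_left (h : IsJBTriple D) (x y z : J) : D (x - y) z = D x z - D y z := by
  rw [eq_sub_iff_add_eq, ← h.add_left, sub_add_cancel]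

theorem sub_mid (h : IsJBTriple D) (x y z : J) : D x (y - z) = D x y - D x z := by
  rw [eq_sub_iff_add_eq, ← h.add_mid, sub_add_cancel]

theorem smul_mid_ofReal (h : IsJBTriple D) (r : ℝ) (x y : J) :
    D x ((r : ℂ) • y) = (r : ℂ) • D x y := by
  rw [h.smul_mid, Complex.conj_ofReal]

theorem eq_zero_of_cube (h : IsJBTriple D) {x : J} (hx : D x x x = 0) : x = 0 := by
  have := h.norm_cube x
  rw [hx, norm_zero] at this
  exact norm_eq_zero.1 (pow_eq_zero_iff (by norm_num) |>.1 this.symm)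

theorem comm_apply (h : IsJBTriple D) (x y u v w : J) :
    D x y (D u v w) - D u v (D x y w) = D (D x y u) v w - D u (D y x v) w := by
  rw [h.jordan x y u v w]; abel

theorem quad_left (h : IsJBTriple D) (x y z : J) : D x (D y x z) x = D x y (D x z x) := by
  have h1 := h.jordan x y x z x
  have h2 := h.jordan x z x y x
  rw [h.symm (D x y x) z x] at h1
  rw [h.symm (D x z x) y x, h.symm x y (D x z x), h.symm z x y] at h2
  rw [h.symm (D x z x) y x] at h2
  linear_combination (norm := module) (1 / 3 : ℂ) • h1 + (2 / 3 : ℂ) • h2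

theorem shift (h : IsJBTriple D) (x y : J) : D (D x y x) y = D x (D y x y) := by
  ext w
  have := h.comm_apply x y x y w
  rw [sub_self] at this
  exact (sub_eq_zero.1 this.symm)

theorem add_comp (h : IsJBTriple D) (x y z w : J) :
    D x y (D z y w) + D z y (D x y w) = D (D x y z) y w + D x (D y w y) z := by
  have := h.jordan w y x y z
  rw [h.symm w y (D x y z), h.symm w y x, h.symm (D x y w) y z, h.symm w y z] at this
  linear_combination (norm := module) -this

theorem two_comp (h : IsJBTriple D) (x y w : J) :
    (2 : ℂ) • D x y (D x y w) = D (D x y x) y w + D x (D y w y) x := by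
  rw [← h.add_comp x y x w]; module

theorem quad_mid (h : IsJBTriple D) (x y z : J) : D (D x y x) z x = D x y (D x z x) := by
  have h1 := h.jordan x y x z x
  rw [h.quad_left x y z, h.symm x z (D x y x)] at h1
  linear_combination (norm := module) (-1 / 2 : ℂ) • h1

theorem fundamental (h : IsJBTriple D) (x y z : J) :
    D (D x y x) z (D x y x) = D x (D y (D x z x) y) x := by
  have e1 := h.two_comp x y (D x z x)
  rw [← h.quad_mid x y z] at e1
  have e2 := h.jordan x y (D x y x) z x
  have e3 := h.jordan (D x y x) y x z x
  have e4 := h.two_comp y x z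
  have e5 := h.quad_mid x y (D y x z)
  rw [← h.quad_left x y (D y x z)] at e5
  have e6 := congrArg (fun t => D x t x) e4
  simp only [h.smul_mid, h.add_mid, add_apply, map_ofNat, smul_apply] at e6
  rw [h.shift y x] at e6
  rw [h.symm x y (D x y x)] at e2
  rw [h.symm (D x y x) y x, h.symm x y (D x y x), h.symm x z (D (D x y x) y x)] at e3
  linear_combination (norm := module) (1 / 2 : ℂ) • (e1 + e3 + e6) - e2 + e5

section Derivation

/-- `δ` is a derivation of the triple product given by `D`. -/
def IsDer (D : J → J → J →L[ℂ] J) (δ : J →L[ℂ] J) : Prop :=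
  ∀ x y z, δ (D x y z) = D (δ x) y z + D x (δ y) z + D x y (δ z)

/-- The second order Taylor polynomial of `exp (s δ)`. -/
noncomputable def taylorTwo (δ : J →L[ℂ] J) (s : ℝ) : J →L[ℂ] J :=
  1 + (s : ℂ) • δ + ((s ^ 2 / 2 : ℝ) : ℂ) • (δ * δ)

theorem taylorTwo_apply (δ : J →L[ℂ] J) (s : ℝ) (x : J) :
    taylorTwo δ s x = x + (s : ℂ) • δ x + ((s ^ 2 / 2 : ℝ) : ℂ) • δ (δ x) := by
  simp [taylorTwo]

theorem norm_le_one_add_of_cube (h : IsJBTriple D) (U : J →L[ℂ] J) {η : ℝ} (hη : 0 ≤ η)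
    (hU : ∀ x, ‖D (U x) (U x) (U x) - U (D x x x)‖ ≤ η * ‖x‖ ^ 3) : ‖U‖ ≤ 1 + η := by
  have hM : 0 ≤ ‖U‖ + η := by positivity
  obtain ⟨c, hc0, hc⟩ : ∃ c : ℝ, 0 ≤ c ∧ c ^ 3 = ‖U‖ + η :=
    ⟨(‖U‖ + η) ^ ((3 : ℕ) : ℝ)⁻¹, by positivity, Real.rpow_inv_natCast_pow hM (by norm_num)⟩
  have hle : ‖U‖ ≤ c := by
    refine U.opNorm_le_bound hc0 fun x => ?_
    rw [← pow_le_pow_iff_left₀ (norm_nonneg _) (by positivity) (three_ne_zero), mul_pow, hc,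
      ← h.norm_cube]
    calc ‖D (U x) (U x) (U x)‖
        = ‖(D (U x) (U x) (U x) - U (D x x x)) + U (D x x x)‖ := by rw [sub_add_cancel]
      _ ≤ η * ‖x‖ ^ 3 + ‖U‖ * ‖x‖ ^ 3 :=
        (norm_add_le _ _).trans (add_le_add (hU x) (by rw [← h.norm_cube]; exact U.le_opNorm _))
      _ = _ := by ring
  have h3 : ‖U‖ ^ 3 ≤ ‖U‖ + η := hc ▸ pow_le_pow_left₀ (norm_nonneg _) hle 3
  by_contra! hcon
  nlinarith [norm_nonneg U, mul_nonneg (norm_nonneg U) (sq_nonneg (‖U‖ - 1)),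
    sq_nonneg (‖U‖ - 1)]

theorem cube_taylorTwo (h : IsJBTriple D) (x u v y : J) (s : ℝ)
    (hy : y = u + ((s / 2 : ℝ) : ℂ) • v) :
    D (x + (s : ℂ) • y) (x + (s : ℂ) • y) (x + (s : ℂ) • y) -
      (D x x x + (s : ℂ) • (D u x x + D x u x + D x x u) +
        ((s ^ 2 / 2 : ℝ) : ℂ) • ((D v x x + D u u x + D u x u) + (D u u x + D x v x + D x u u) +
          (D u x u + D x u u + D x x v))) =
      ((s ^ 3 : ℝ) : ℂ) • (D y y y + D v y x + D u v x + (1 / 2 : ℂ) • D v x y +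
        (1 / 2 : ℂ) • D u x v) := by
  subst hy
  simp only [h.add_left, h.add_mid, h.smul_left, h.smul_mid_ofReal, map_add, map_smul, add_apply,
    smul_apply, h.symm x _ u, h.symm x _ v, h.symm u _ v]
  push_cast
  module

theorem IsDer.exists_norm_taylorTwo_le (h : IsJBTriple D) {δ : J →L[ℂ] J} (hδ : IsDer D δ) :
    ∃ C : ℝ, 0 ≤ C ∧ ∀ s : ℝ, |s| ≤ 1 → ‖taylorTwo δ s‖ ≤ 1 + C * |s| ^ 3 := by
  set k : ℝ := 1 + ‖δ‖ + ‖δ‖ ^ 2 with hk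
  have hk1 : 1 ≤ k := by rw [hk]; nlinarith [norm_nonneg δ, sq_nonneg ‖δ‖]
  refine ⟨12 * k ^ 3, by positivity, fun s hs => ?_⟩
  refine h.norm_le_one_add_of_cube _ (by positivity) fun x => ?_
  set y : J := δ x + ((s / 2 : ℝ) : ℂ) • δ (δ x) with hy
  have hUx : taylorTwo δ s x = x + (s : ℂ) • y := by
    rw [taylorTwo_apply, hy]
    push_cast; module
  have b0 : ‖x‖ ≤ k * ‖x‖ := by nlinarith [norm_nonneg x]
  have b1 : ‖δ x‖ ≤ ‖δ‖ * ‖x‖ := δ.le_opNorm x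
  have b2 : ‖δ (δ x)‖ ≤ ‖δ‖ ^ 2 * ‖x‖ := by
    have := (δ.le_opNorm (δ x)).trans (mul_le_mul_of_nonneg_left b1 (norm_nonneg _))
    linarith [this, sq ‖δ‖, mul_assoc ‖δ‖ ‖δ‖ ‖x‖, congrArg (· * ‖x‖) (sq ‖δ‖)]
  have b1' : ‖δ x‖ ≤ k * ‖x‖ := b1.trans (by gcongr; nlinarith [sq_nonneg ‖δ‖])
  have b2' : ‖δ (δ x)‖ ≤ k * ‖x‖ := b2.trans (by gcongr; nlinarith [norm_nonneg δ])
  have by' : ‖y‖ ≤ k * ‖x‖ := by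
    have : ‖((s / 2 : ℝ) : ℂ) • δ (δ x)‖ ≤ ‖δ (δ x)‖ := by
      rw [norm_smul, Complex.norm_real, Real.norm_eq_abs, abs_div, abs_two]
      nlinarith [norm_nonneg (δ (δ x)), abs_nonneg s]
    refine (norm_add_le _ _).trans ((add_le_add b1 (this.trans b2)).trans ?_)
    nlinarith [norm_nonneg x]
  have key : ∀ p q r : J, ‖p‖ ≤ k * ‖x‖ → ‖q‖ ≤ k * ‖x‖ → ‖r‖ ≤ k * ‖x‖ →
      ‖D p q r‖ ≤ 3 * (k * ‖x‖) ^ 3 := fun p q r hp hq hr => by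
    refine (h.norm_le p q r).trans ?_
    calc 3 * ‖p‖ * ‖q‖ * ‖r‖ ≤ 3 * (k * ‖x‖) * (k * ‖x‖) * (k * ‖x‖) := by gcongr
      _ = _ := by ring
  rw [hUx, taylorTwo_apply, hδ x x x, map_add δ, map_add δ, hδ, hδ, hδ]
  rw [h.cube_taylorTwo x (δ x) (δ (δ x)) y s hy, norm_smul, Complex.norm_real, Real.norm_eq_abs,
    abs_pow]
  have half : ∀ z : J, ‖(1 / 2 : ℂ) • z‖ = ‖z‖ / 2 := fun z => by
    rw [norm_smul]; norm_num; ring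
  have hR : ‖D y y y + D (δ (δ x)) y x + D (δ x) (δ (δ x)) x + (1 / 2 : ℂ) • D (δ (δ x)) x y +
        (1 / 2 : ℂ) • D (δ x) x (δ (δ x))‖ ≤ 12 * (k * ‖x‖) ^ 3 := by
    refine norm_add_le_of_le (norm_add_le_of_le (norm_add_le_of_le (norm_add_le_of_le
      (key _ _ _ by' by' by') (key _ _ _ b2' by' b0)) (key _ _ _ b1' b2' b0))
      ((half _).trans_le (div_le_div_of_nonneg_right (key _ _ _ b2' b0 by') zero_le_two)))
      ((half _).trans_le (div_le_div_of_nonneg_right (key _ _ _ b1' b0 b2') zero_le_two))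
      |>.trans ?_
    linarith
  calc |s| ^ 3 * _ ≤ |s| ^ 3 * (12 * (k * ‖x‖) ^ 3) := by gcongr
    _ = _ := by ring

theorem IsDer.eq_zero_of_apply_apply (h : IsJBTriple D) {δ : J →L[ℂ] J} (hδ : IsDer D δ) {w : J}
    (hw : δ (δ w) = 0) : δ w = 0 := by
  obtain ⟨C, hC, hle⟩ := hδ.exists_norm_taylorTwo_le h
  have hpow : ∀ (s : ℝ) (n : ℕ), (taylorTwo δ s ^ n) w = w + ((n * s : ℝ) : ℂ) • δ w := by
    intro s n
    induction n with
    | zero => simp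
    | succ n ih =>
      rw [pow_succ', mul_apply_eq_comp, ih]
      simp only [taylorTwo_apply, map_add, map_smul, hw, map_zero, smul_zero]
      push_cast; module
  have hm : ∀ m : ℕ, (m : ℝ) * ‖δ w‖ ≤ Real.exp C * ‖w‖ + ‖w‖ := by
    intro m
    rcases Nat.eq_zero_or_pos m with rfl | hm0
    · simp; positivity
    have hm1 : (1 : ℝ) ≤ m := by exact_mod_cast hm0
    have e1 := hpow (1 / m) (m ^ 2)
    have e2 : ((m ^ 2 : ℕ) * (1 / m) : ℝ) = m := by push_cast; field_simp
    rw [e2] at e1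
    have habs : |(1 / m : ℝ)| = 1 / m := abs_of_nonneg (by positivity)
    have hU : ‖taylorTwo δ (1 / m)‖ ≤ Real.exp (C * (1 / m) ^ 3) := by
      have := hle (1 / m) (by rw [habs, div_le_one (by positivity)]; exact hm1)
      rw [habs] at this
      exact this.trans (by linarith [Real.add_one_le_exp (C * (1 / m : ℝ) ^ 3)])
    have hUn : ‖(taylorTwo δ (1 / m) ^ (m ^ 2)) w‖ ≤ Real.exp C * ‖w‖ := by
      refine (ContinuousLinearMap.le_opNorm _ _).trans ?_
      gcongr
      refine (norm_pow_le' _ (by positivity)).trans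
        ((pow_le_pow_left₀ (norm_nonneg _) hU _).trans ?_)
      rw [← Real.exp_nat_mul]
      gcongr
      have : ((m ^ 2 : ℕ) : ℝ) * (C * (1 / m) ^ 3) = C * (1 / m) := by push_cast; field_simp
      rw [this]
      exact mul_le_of_le_one_right hC (by rw [div_le_one (by positivity)]; exact hm1)
    have e3 : ((m : ℝ) : ℂ) • δ w = (taylorTwo δ (1 / m) ^ (m ^ 2)) w - w := by rw [e1]; abel
    have e4 := congrArg norm e3
    rw [norm_smul, Complex.norm_real, Real.norm_eq_abs, abs_of_nonneg (by positivity)] at e4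
    rw [e4]
    exact (norm_sub_le _ _).trans (by gcongr)
  by_contra hne
  have hpos : 0 < ‖δ w‖ := norm_pos_iff.2 hne
  obtain ⟨m, hm'⟩ := exists_nat_gt ((Real.exp C * ‖w‖ + ‖w‖) / ‖δ w‖)
  rw [div_lt_iff₀ hpos] at hm'
  exact absurd (hm m) (not_le.2 hm')

theorem IsDer.eq_zero_of_pow (h : IsJBTriple D) {δ : J →L[ℂ] J} (hδ : IsDer D δ) (n : ℕ)
    (hn : δ ^ n = 0) : δ = 0 := by
  suffices H : ∀ n : ℕ, ∀ w, (δ ^ (n + 1)) w = 0 → δ w = 0 by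
    ext w
    exact H n w (by rw [pow_succ', hn, mul_zero]; rfl)
  intro n
  induction n with
  | zero => intro w hw; simpa using hw
  | succ n ih =>
    intro w hw
    refine hδ.eq_zero_of_apply_apply h (ih (δ w) ?_)
    rwa [pow_succ, mul_apply_eq_comp] at hw

end Derivation

section Orthogonal

theorem isDer_sub (h : IsJBTriple D) (x y : J) : IsDer D (D x y - D y x) := by
  intro u v w
  simp only [sub_apply, h.jordan x y u v w, h.jordan y x u v w, h.sub_left, h.sub_mid, map_sub]
  abel

theorem isDer_I_smul_add (h : IsJBTriple D) (x y : J) : IsDer D (Complex.I • (D x y + D y x)) := by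
  intro u v w
  simp only [add_apply, smul_apply, h.jordan x y u v w, h.jordan y x u v w, h.add_left, h.add_mid,
    h.smul_left, h.smul_mid, map_add, map_smul, Complex.conj_I]
  module

theorem pow_three_eq_zero (h : IsJBTriple D) {a b : J} (hab : D a b a = 0) : D a b ^ 3 = 0 := by
  have hq : ∀ y, D a b (D a y a) = 0 := fun y => by
    have h1 := h.quad_left a b y
    have h2 := h.jordan a b a y a
    rw [hab, h.zero_left, zero_apply, map_zero, h1] at h2
    linear_combination (norm := module) (1 / 2 : ℂ) • h2
  ext w
  have h3 := h.two_comp a b w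
  rw [hab, h.zero_left, zero_apply, zero_add] at h3
  have h4 := congrArg (D a b) h3
  rw [hq, map_smul] at h4
  simpa [pow_succ] using h4

/-- If `D a a b = 0` and the same holds for the relevant odd powers of `a`, then `a` and `b` are
orthogonal. -/
theorem eq_zero_of_apply_self_eq_zero (h : IsJBTriple D) {a : J}
    (hK : ∀ b, D a a b = 0 → D (D a a a) a b = 0) {b : J} (hb : D a a b = 0) : D a b = 0 := by
  have quad : ∀ b, D a a b = 0 → D a b a = 0 := fun b hb => by
    have h1 := h.two_comp a a b
    rw [hb, hK b hb, map_zero, smul_zero, zero_add] at h1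
    refine h.eq_zero_of_cube ?_
    rw [h.fundamental a b, ← h1, h.zero_mid, zero_apply, h.zero_mid, zero_apply]
  have sub : ∀ b c d, D a a b = 0 → D a a c = 0 → D a a d = 0 → D a a (D b c d) = 0 :=
    fun b c d hb hc hd => by
      rw [h.jordan, hb, hc, hd, h.zero_left, h.zero_mid, map_zero, zero_apply, sub_zero, add_zero]
  have flip : ∀ b, D a a b = 0 → D b a a = 0 := fun b hb => by rw [← h.symm, hb]
  have quad' : ∀ b, D a a b = 0 → D b a b = 0 := fun b hb => by
    have hua : D (D b a b) a = 0 := by rw [h.shift, quad b hb, h.zero_mid]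
    set u := D b a b with hu
    set t := D a b u with ht
    have hta : D t a = 0 := by
      ext w
      have := h.comm_apply a b u a w
      rw [hua, flip b hb, h.zero_mid] at this
      simpa using this.symm
    have ht0 : t = 0 := by
      refine h.eq_zero_of_cube ?_
      have := h.jordan b u t a t
      rw [h.symm (D b u t) a t, hta, ← h.symm a b u, ← ht] at this
      simpa using this
    refine h.eq_zero_of_cube ?_
    have h2 := h.two_comp a b u
    rw [← ht, ht0, quad b hb, h.zero_left, map_zero, smul_zero, zero_apply, zero_add] at h2
    rw [hu, h.fundamental b a, ← hu, ← h2, h.zero_mid, zero_apply]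
  have pol : ∀ b c, D a a b = 0 → D a a c = 0 → D b a c = 0 := fun b c hb hc => by
    have := quad' (b + c) (by rw [map_add, hb, hc, add_zero])
    rw [h.add_left, add_apply, map_add, map_add, quad' b hb, quad' c hc, h.symm c a b] at this
    linear_combination (norm := module) (1 / 2 : ℂ) • this
  have hcomm : ∀ w, D a b (D b a w) - D b a (D a b w) = D (D a b b) a w := fun w => by
    rw [h.comm_apply, flip b hb, h.zero_mid, zero_apply, sub_zero]
  have hv : D a b b = 0 := by
    have hva : D a a (D a b b) = 0 := by
      rw [h.symm, ← hcomm, flip b hb, quad b hb, map_zero, map_zero, sub_zero]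
    refine h.eq_zero_of_cube ?_
    have := h.jordan b b (D a b b) a (D a b b)
    rw [pol _ _ hva hva, pol _ _ (sub _ _ _ hb hb hva) hva, pol _ _ hva (sub _ _ _ hb hb hva),
      ← h.symm a b b] at this
    simpa using this
  have hC : Commute (D a b) (D b a) := by
    ext w
    have := hcomm w
    rw [hv, h.zero_left, zero_apply] at this
    exact sub_eq_zero.1 this
  have hT : IsNilpotent (D a b) := ⟨3, h.pow_three_eq_zero (quad b hb)⟩
  have hT' : IsNilpotent (D b a) := ⟨3, h.pow_three_eq_zero (quad' b hb)⟩
  obtain ⟨n, hn⟩ := hC.isNilpotent_sub hT hT'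
  obtain ⟨m, hm⟩ := (hC.isNilpotent_add hT hT').smul Complex.I
  have e1 := (h.isDer_sub a b).eq_zero_of_pow h n hn
  have e2 := (h.isDer_I_smul_add a b).eq_zero_of_pow h m hm
  rw [smul_eq_zero, or_iff_right Complex.I_ne_zero] at e2
  linear_combination (norm := module) (1 / 2 : ℂ) • (e1 + e2)

end Orthogonal

section Powers

open Polynomial

/-- The odd power `{a,a,…,{a,a,a}}` of `a`. -/
noncomputable def oddPow (D : J → J → J →L[ℂ] J) (a : J) (n : ℕ) : J := (D a a ^ n) a

theorem oddPow_zero (a : J) : oddPow D a 0 = a := rfl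

theorem oddPow_succ (a : J) (n : ℕ) : oddPow D a (n + 1) = D a a (oddPow D a n) := by
  rw [oddPow, pow_succ']; rfl

theorem quad_oddPow (h : IsJBTriple D) (a : J) (n : ℕ) :
    D a (oddPow D a n) a = oddPow D a (n + 1) := by
  induction n with
  | zero => rfl
  | succ n ih => rw [oddPow_succ, h.quad_left, ih, oddPow_succ a (n + 1)]

theorem comm_oddPow_apply (h : IsJBTriple D) (a : J) (i j : ℕ) :
    D a a * D (oddPow D a i) (oddPow D a j) - D (oddPow D a i) (oddPow D a j) * D a a =
      D (oddPow D a (i + 1)) (oddPow D a j) - D (oddPow D a i) (oddPow D a (j + 1)) := by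
  ext w
  simpa [oddPow_succ] using h.comm_apply a a (oddPow D a i) (oddPow D a j) w

theorem oddPow_add_and_commute (h : IsJBTriple D) (a : J) (n : ℕ) :
    (∀ i j, i + j = n → D (oddPow D a i) (oddPow D a j) = D (oddPow D a n) a) ∧
      Commute (D a a) (D (oddPow D a n) a) := by
  induction n with
  | zero =>
    refine ⟨fun i j hij => ?_, Commute.refl _⟩
    obtain ⟨rfl, rfl⟩ := Nat.add_eq_zero_iff.1 hij
    rfl
  | succ n ih =>
    obtain ⟨ih1, ih2⟩ := ih
    have step : ∀ i j, i + j = n + 1 →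
        D (oddPow D a i) (oddPow D a j) = D (oddPow D a (n + 1)) a := by
      intro i j
      induction j generalizing i with
      | zero => rintro rfl; rfl
      | succ j ihj =>
        intro hij
        rw [← ihj (i + 1) (by omega)]
        have := h.comm_oddPow_apply a i j
        rw [ih1 i j (by omega), ih2.eq, sub_self] at this
        exact (sub_eq_zero.1 this.symm).symm
    refine ⟨step, ?_⟩
    set C := D a a * D (oddPow D a (n + 1)) a - D (oddPow D a (n + 1)) a * D a a with hC
    have tele : ∀ k j, k + j = n + 2 →
        D (oddPow D a k) (oddPow D a j) = D a (oddPow D a (n + 2)) + (k : ℂ) • C := by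
      intro k
      induction k with
      | zero =>
        intro j hj
        obtain rfl : j = n + 2 := by omega
        simp [oddPow_zero]
      | succ k ihk =>
        intro j hj
        have e1 := h.comm_oddPow_apply a k j
        rw [step k j (by omega), ← hC, ihk (j + 1) (by omega)] at e1
        rw [eq_sub_iff_add_eq] at e1
        rw [← e1]; push_cast; module
    have e2 : D (oddPow D a (n + 1)) a * D a a - D a a * D (oddPow D a (n + 1)) a =
        D (oddPow D a (n + 2)) a - D a (oddPow D a (n + 2)) := by
      rw [← step 0 (n + 1) (by omega)]
      ext w
      have := h.comm_apply a (oddPow D a (n + 1)) a a w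
      rw [h.quad_oddPow, h.symm (oddPow D a (n + 1)) a a, ← oddPow_succ] at this
      simpa [oddPow_zero] using this
    have e3 := tele (n + 2) 0 (by omega)
    rw [oddPow_zero] at e3
    have e4 : ((n : ℂ) + 3) • C = 0 := by
      have : -C = D (oddPow D a (n + 2)) a - D a (oddPow D a (n + 2)) := by rw [← e2, hC]; abel
      rw [e3] at this
      push_cast at this
      linear_combination (norm := module) -this
    have hn : ((n : ℂ) + 3) ≠ 0 := by exact_mod_cast (by omega : n + 3 ≠ 0)
    exact sub_eq_zero.1 ((smul_eq_zero.1 e4).resolve_left hn)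

theorem map_oddPow (h : IsJBTriple D) (a : J) (i j : ℕ) :
    D (oddPow D a i) (oddPow D a j) = D (oddPow D a (i + j)) a :=
  (h.oddPow_add_and_commute a (i + j)).1 i j rfl

theorem commute_oddPow (h : IsJBTriple D) (a : J) (n : ℕ) :
    Commute (D a a) (D (oddPow D a n) a) :=
  (h.oddPow_add_and_commute a n).2

theorem aeval_add_apply (a : J) (f g : ℝ[X]) :
    aeval (D a a) (f + g) a = aeval (D a a) f a + aeval (D a a) g a := by
  rw [map_add]; rfl

theorem aeval_monomial_apply (a : J) (n : ℕ) (r : ℝ) :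
    aeval (D a a) (monomial n r) a = (r : ℂ) • oddPow D a n := by
  rw [aeval_monomial, Algebra.algebraMap_eq_smul_one, smul_mul_assoc, one_mul, oddPow]
  rfl

theorem map_aeval_aeval (h : IsJBTriple D) (a : J) (f g : ℝ[X]) :
    D (aeval (D a a) f a) (aeval (D a a) g a) = D (aeval (D a a) (f * g) a) a := by
  induction f using Polynomial.induction_on' with
  | add p q hp hq =>
    rw [aeval_add_apply, h.add_left, hp, hq, add_mul, aeval_add_apply, h.add_left]
  | monomial n r =>
    induction g using Polynomial.induction_on' with
    | add p q hp hq =>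
      rw [aeval_add_apply, h.add_mid, hp, hq, mul_add, aeval_add_apply, h.add_left]
    | monomial m s =>
      rw [monomial_mul_monomial, aeval_monomial_apply, aeval_monomial_apply, aeval_monomial_apply,
        h.smul_left, h.smul_mid_ofReal, h.map_oddPow, h.smul_left, smul_smul]
      push_cast; rfl

theorem commute_aeval (h : IsJBTriple D) (a : J) (f : ℝ[X]) :
    Commute (D a a) (D (aeval (D a a) f a) a) := by
  induction f using Polynomial.induction_on' with
  | add p q hp hq => rw [aeval_add_apply, h.add_left]; exact hp.add_right hq
  | monomial n r =>
    rw [aeval_monomial_apply, h.smul_left]; exact (h.commute_oddPow a n).smul_right _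

theorem map_aeval_apply_self (h : IsJBTriple D) (a : J) (f : ℝ[X]) :
    D (aeval (D a a) f a) a a = aeval (D a a) (X * f) a := by
  rw [h.symm, map_mul, aeval_X]; rfl

theorem commute_aeval_right {R A : Type*} [CommSemiring R] [Semiring A] [Algebra R A] {x y : A}
    (hxy : Commute x y) (p : R[X]) : Commute x (aeval y p) := by
  induction p using Polynomial.induction_on' with
  | add p q hp hq => rw [map_add]; exact hp.add_right hq
  | monomial n r =>
    rw [aeval_monomial]
    exact (Algebra.commute_algebraMap_right r x).mul_right (hxy.pow_right n)

theorem cube_aeval (h : IsJBTriple D) (a : J) (f : ℝ[X]) :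
    D (aeval (D a a) f a) (aeval (D a a) f a) (aeval (D a a) f a) =
      aeval (D a a) (X * f ^ 2 * f) a := by
  have e1 := commute_aeval_right (h.commute_aeval a (f * f)).symm f
  calc _ = (D (aeval (D a a) (f * f) a) a * aeval (D a a) f) a := by rw [h.map_aeval_aeval]; rfl
    _ = aeval (D a a) f (aeval (D a a) (X * (f * f)) a) := by
      rw [e1.eq, mul_apply_eq_comp, h.map_aeval_apply_self]
    _ = _ := by
      rw [← mul_apply_eq_comp, ← map_mul]; congr 2; ring

end Powers

section Spectral

open Polynomial Filter

theorem le_of_pow_three_pow_le {x y C : ℝ} (hy : 0 ≤ y)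
    (hxy : ∀ i : ℕ, x ^ 3 ^ i ≤ C * y ^ 3 ^ i) : x ≤ y := by
  by_contra! hlt
  rcases hy.eq_or_lt with rfl | hy0
  · have := hxy 0
    simp at this
    linarith
  have hr : 1 < x / y := (one_lt_div hy0).2 hlt
  obtain ⟨n, hn⟩ := exists_nat_gt (C / (x / y - 1))
  rw [div_lt_iff₀ (by linarith)] at hn
  have h1 : (x / y) ^ 3 ^ n ≤ C := by
    rw [div_pow, div_le_iff₀ (by positivity)]; exact hxy n
  have h2 := one_add_mul_le_pow (by linarith : (-2 : ℝ) ≤ x / y - 1) (3 ^ n)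
  have h3 : (n : ℝ) ≤ ((3 ^ n : ℕ) : ℝ) := by exact_mod_cast (Nat.lt_pow_self (by norm_num)).le
  rw [add_sub_cancel] at h2
  nlinarith

theorem eventually_norm_pow_lt {A : Type*} [NormedRing A] [NormedAlgebra ℂ A] [CompleteSpace A]
    [Nontrivial A] (T : A) {r : ℝ} (hr : 0 ≤ r) (hT : ∀ z ∈ spectrum ℂ T, ‖z‖ < r) :
    ∀ᶠ n : ℕ in atTop, ‖T ^ n‖ < r ^ n := by
  lift r to NNReal using hr
  have h1 := spectrum.spectralRadius_lt_of_forall_lt T (r := r) fun z hz => hT z hz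
  filter_upwards [
    (spectrum.pow_nnnorm_pow_one_div_tendsto_nhds_spectralRadius T).eventually_lt_const h1,
    eventually_gt_atTop 0] with n hn hn0
  have hn1 : (0 : ℝ) < n := by exact_mod_cast hn0
  have hn2 := ENNReal.rpow_lt_rpow hn hn1
  rw [← ENNReal.rpow_mul, one_div_mul_cancel hn1.ne', ENNReal.rpow_one, ENNReal.rpow_natCast] at hn2
  exact_mod_cast hn2

variable {V : Type*} [NormedAddCommGroup V] [NormedSpace ℂ V]

/-- `S` is the restriction of `T` to the closed cyclic subspace generated by `a`, which is embedded
by `ι`; the vector `v` corresponds to `a`. -/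
structure IsCyclic (T : J →L[ℂ] J) (a : J) (ι : V →ₗᵢ[ℂ] J) (S : V →L[ℂ] V) (v : V) : Prop where
  apply : ∀ x, ι (S x) = T (ι x)
  base : ι v = a
  dense : Dense (Set.range fun p : ℂ[X] => aeval S p v)

variable {a : J} {ι : V →ₗᵢ[ℂ] J} {S : V →L[ℂ] V} {v : V}

theorem map_aeval_of_map_eq {T : J →L[ℂ] J} (hS : ∀ x, ι (S x) = T (ι x)) (p : ℂ[X]) (x : V) :
    ι (aeval S p x) = aeval T p (ι x) := by
  have hpow : ∀ (n : ℕ) (x : V), ι ((S ^ n) x) = (T ^ n) (ι x) := fun n => by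
    induction n with
    | zero => intro x; rfl
    | succ n ih => intro x; rw [pow_succ, pow_succ, mul_apply_eq_comp, ih, hS]; rfl
  induction p using Polynomial.induction_on' with
  | add p q hp hq => rw [map_add, map_add, add_apply, add_apply, map_add, hp, hq]
  | monomial n r =>
    simp only [aeval_monomial, Algebra.algebraMap_eq_smul_one, smul_mul_assoc, one_mul, smul_apply,
      map_smul, hpow]

theorem IsCyclic.map_aeval {T : J →L[ℂ] J} (hS : IsCyclic T a ι S v) (p : ℂ[X]) (x : V) :
    ι (aeval S p x) = aeval T p (ι x) :=
  map_aeval_of_map_eq hS.apply p x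

theorem IsCyclic.map_aeval_real {T : J →L[ℂ] J} (hS : IsCyclic T a ι S v) (p : ℝ[X]) (x : V) :
    ι (aeval S p x) = aeval T p (ι x) := by
  rw [← aeval_map_algebraMap ℂ, hS.map_aeval, aeval_map_algebraMap]

theorem IsCyclic.map_aeval_apply (h : IsJBTriple D) (hS : IsCyclic (D a a) a ι S v) (f g : ℝ[X])
    (x : V) : D (aeval (D a a) f a) (aeval (D a a) g a) (ι x) =
      ι (aeval S (X * (f * g)) x) := by
  have hcont : Continuous fun x => D (aeval (D a a) f a) (aeval (D a a) g a) (ι x) := by fun_prop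
  have hcont' : Continuous fun x => ι (aeval S (X * (f * g)) x) := by fun_prop
  refine congrFun (Continuous.ext_on hS.dense hcont hcont' ?_) x
  rintro _ ⟨p, rfl⟩
  have e1 := commute_aeval_right (h.commute_aeval a (f * g)).symm p
  have e2 := commute_aeval_right (commute_aeval_right (Commute.refl (D a a)) p).symm (X * (f * g))
  beta_reduce
  calc _ = (D (aeval (D a a) (f * g) a) a * aeval (D a a) p) a := by
        rw [h.map_aeval_aeval, hS.map_aeval, hS.base]; rfl
    _ = (aeval (D a a) p * aeval (D a a) (X * (f * g))) a := by
        rw [e1.eq, mul_apply_eq_comp, h.map_aeval_apply_self]; rfl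
    _ = _ := by
        rw [e2.eq, mul_apply_eq_comp, hS.map_aeval_real, hS.map_aeval, hS.base]

end Spectral

section SpectralBounds

open Polynomial Filter

variable {V : Type*} [NormedAddCommGroup V] [NormedSpace ℂ V] [CompleteSpace V] [Nontrivial V]
variable {a : J} {ι : V →ₗᵢ[ℂ] J} {S : V →L[ℂ] V} {v : V}

/-- The coordinate polynomials of the iterated cubes of `aeval (D a a) f a`. -/
noncomputable def cubeIter (f : ℝ[X]) : ℕ → ℝ[X]
  | 0 => f
  | i + 1 => X * cubeIter f i ^ 2 * cubeIter f i

theorem X_mul_cubeIter_sq (f : ℝ[X]) (i : ℕ) :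
    X * (cubeIter f i * cubeIter f i) = (X * f ^ 2) ^ 3 ^ i := by
  induction i with
  | zero => simp [cubeIter, sq]
  | succ i ih => rw [pow_succ 3, pow_mul, ← ih, cubeIter]; ring

theorem exists_cubeIter_eq (f : ℝ[X]) (i : ℕ) :
    ∃ j, 2 * j + 1 = 3 ^ i ∧ cubeIter f i = (X * f ^ 2) ^ j * f := by
  induction i with
  | zero => exact ⟨0, by simp [cubeIter]⟩
  | succ i ih =>
    obtain ⟨j, hj, hf⟩ := ih
    exact ⟨3 * j + 1, by rw [pow_succ]; omega, by rw [cubeIter, hf]; ring⟩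

theorem norm_cubeIter (h : IsJBTriple D) (a : J) (f : ℝ[X]) (i : ℕ) :
    ‖aeval (D a a) (cubeIter f i) a‖ = ‖aeval (D a a) f a‖ ^ 3 ^ i := by
  induction i with
  | zero => simp [cubeIter]
  | succ i ih => rw [cubeIter, ← h.cube_aeval, h.norm_cube, ih, pow_succ 3, pow_mul]

theorem IsCyclic.im_eq_zero (h : IsJBTriple D) (hS : IsCyclic (D a a) a ι S v) {z : ℂ}
    (hz : z ∈ spectrum ℂ S) : z.im = 0 := by
  obtain ⟨K, hK0, hle⟩ := (h.isDer_I_smul_add a a).exists_norm_taylorTwo_le h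
  have hU : ∀ s : ℝ, |s| ≤ 1 → ‖taylorTwo (Complex.I • (S + S)) s‖ ≤ 1 + K * |s| ^ 3 := by
    intro s hs
    refine ContinuousLinearMap.opNorm_le_bound _ (by positivity) fun x => ?_
    have : ι (taylorTwo (Complex.I • (S + S)) s x) =
        taylorTwo (Complex.I • (D a a + D a a)) s (ι x) := by
      simp only [taylorTwo_apply, map_add, map_smul, smul_apply, add_apply, hS.apply]
    rw [← ι.norm_map, this, ← ι.norm_map x]
    exact ContinuousLinearMap.le_of_opNorm_le _ (hle s hs) _
  have hre : ∀ s : ℝ, |s| ≤ 1 →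
      1 - 2 * s * z.im - 2 * s ^ 2 * (z.re ^ 2 - z.im ^ 2) ≤ 1 + K * |s| ^ 3 := by
    intro s hs
    have hmem := spectrum.subset_polynomial_aeval S
      (1 + C (2 * Complex.I * s) * X + C (2 * s ^ 2 * (Complex.I * Complex.I)) * X ^ 2) ⟨z, hz, rfl⟩
    have hSU : aeval S (1 + C (2 * Complex.I * s) * X + C (2 * s ^ 2 * (Complex.I * Complex.I)) * X ^ 2)
        = taylorTwo (Complex.I • (S + S)) s := by
      ext x
      simp only [map_add, map_mul, map_one, aeval_C, aeval_X,
        Algebra.algebraMap_eq_smul_one, taylorTwo_apply, sq, add_apply, smul_apply,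
        mul_apply_eq_comp, one_apply_eq_self, map_smul]
      push_cast
      module
    rw [hSU] at hmem
    refine le_trans ?_ ((spectrum.norm_le_norm_of_mem hmem).trans (hU s hs))
    refine le_trans (le_of_eq ?_) (Complex.re_le_norm _)
    simp [sq]
    ring
  have hK : ∀ t : ℝ, 0 < t → t ≤ 1 → |z.im| ≤ t * (K + z.re ^ 2 + z.im ^ 2) := by
    intro t ht ht1
    have h1 := hre t (by rwa [abs_of_pos ht])
    have h2 := hre (-t) (by rwa [abs_neg, abs_of_pos ht])
    rw [abs_neg] at h2
    rw [abs_of_pos ht] at h1 h2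
    have h3 : t ^ 3 ≤ t ^ 2 := by nlinarith [sq_nonneg t]
    have h4 : K * t ^ 3 ≤ K * t ^ 2 := by gcongr
    refine abs_le.2 ⟨?_, ?_⟩ <;> refine le_of_mul_le_mul_left ?_ ht <;>
      nlinarith [mul_nonneg hK0 (sq_nonneg t), mul_nonneg (sq_nonneg t) (sq_nonneg z.re),
        mul_nonneg (sq_nonneg t) (sq_nonneg z.im)]
  by_contra hne
  have hpos : 0 < |z.im| := abs_pos.2 hne
  have hK' : 0 < K + z.re ^ 2 + z.im ^ 2 := by positivity
  have hmin := hK (min 1 (|z.im| / (2 * (K + z.re ^ 2 + z.im ^ 2)))) (by positivity)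
    (min_le_left _ _)
  have hlt : min 1 (|z.im| / (2 * (K + z.re ^ 2 + z.im ^ 2))) * (K + z.re ^ 2 + z.im ^ 2) ≤
      |z.im| / 2 := by
    refine (mul_le_mul_of_nonneg_right (min_le_right _ _) hK'.le).trans (le_of_eq ?_)
    field_simp
  linarith

theorem IsCyclic.norm_le_of_mem_spectrum (h : IsJBTriple D) (hS : IsCyclic (D a a) a ι S v)
    (f : ℝ[X]) {z : ℂ} (hz : z ∈ spectrum ℂ S) :
    ‖aeval z (X * f ^ 2)‖ ≤ ‖aeval (D a a) f a‖ ^ 2 := by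
  refine le_of_pow_three_pow_le (C := 3) (by positivity) fun i => ?_
  have hmem := spectrum.subset_polynomial_aeval S
    (((X * f ^ 2) ^ 3 ^ i).map (algebraMap ℝ ℂ)) ⟨z, hz, rfl⟩
  rw [aeval_map_algebraMap] at hmem
  beta_reduce at hmem
  rw [eval_map_algebraMap, map_pow (aeval z)] at hmem
  have hle := spectrum.norm_le_norm_of_mem hmem
  rw [norm_pow] at hle
  refine hle.trans (ContinuousLinearMap.opNorm_le_bound _ (by positivity) fun x => ?_)
  rw [← ι.norm_map, ← X_mul_cubeIter_sq, ← hS.map_aeval_apply h, ← ι.norm_map x]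
  refine (h.norm_le _ _ _).trans (le_of_eq ?_)
  rw [h.norm_cubeIter]; ring

theorem IsCyclic.norm_sq_le_of_spectrum (h : IsJBTriple D) (hS : IsCyclic (D a a) a ι S v)
    (f : ℝ[X]) {s : ℝ} (hs : 0 ≤ s) (hf : ∀ z ∈ spectrum ℂ S, ‖aeval z (X * f ^ 2)‖ ≤ s) :
    ‖aeval (D a a) f a‖ ^ 2 ≤ s := by
  set N := ‖aeval (D a a) f a‖ with hN
  refine le_of_forall_gt_imp_ge_of_dense fun r hr => ?_
  by_cases hN0 : N = 0
  · rw [hN0]; nlinarith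
  have h0 : 0 < N := lt_of_le_of_ne (norm_nonneg _) (Ne.symm hN0)
  have hσ : ∀ z ∈ spectrum ℂ (aeval S (X * f ^ 2)), ‖z‖ < r := by
    intro z hz
    rw [← aeval_map_algebraMap ℂ,
      spectrum.map_polynomial_aeval_of_nonempty _ _ (spectrum.nonempty S)] at hz
    obtain ⟨w, hw, rfl⟩ := hz
    beta_reduce
    rw [eval_map_algebraMap]
    exact (hf w hw).trans_lt hr
  obtain ⟨n, hn⟩ := eventually_atTop.1 (eventually_norm_pow_lt _ (hs.trans hr.le) hσ)
  obtain ⟨j, hj, hfj⟩ := exists_cubeIter_eq f (n + 1)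
  have hnj : n ≤ j := by
    have : n + 1 < 3 ^ (n + 1) := Nat.lt_pow_self (by norm_num)
    have h2 : n < 3 ^ n := Nat.lt_pow_self (by norm_num)
    rw [pow_succ] at hj
    omega
  have e1 : N ^ (2 * j + 1) ≤ ‖aeval S (X * f ^ 2) ^ j‖ * N := by
    have e0 : aeval (D a a) f a = ι (aeval S f v) := by rw [hS.map_aeval_real, hS.base]
    rw [hj, hN, ← h.norm_cubeIter, hfj, map_mul, mul_apply_eq_comp, e0, ← hS.map_aeval_real,
      ι.norm_map, ι.norm_map, map_pow (aeval S)]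
    exact ContinuousLinearMap.le_opNorm _ _
  rw [pow_succ, pow_mul] at e1
  have e2 := (le_of_mul_le_mul_right e1 h0).trans_lt (hn j hnj)
  exact (lt_of_pow_lt_pow_left₀ j (hs.trans hr.le) e2).le

end SpectralBounds

end IsJBTriple

namespace IsPosTriple

open Polynomial IsJBTriple

variable {J : Type*} [NormedAddCommGroup J] [NormedSpace ℂ J] {D : J → J → J →L[ℂ] J}

theorem norm_aeval_ofReal (l : ℝ) (f : ℝ[X]) :
    ‖aeval (l : ℂ) (X * f ^ 2)‖ = |l| * f.eval l ^ 2 := by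
  have : aeval (l : ℂ) (X * f ^ 2) = ((l * f.eval l ^ 2 : ℝ) : ℂ) := by
    rw [← Complex.coe_algebraMap, aeval_algebraMap_apply]
    simp
  rw [this, Complex.norm_real, Real.norm_eq_abs, abs_mul, abs_of_nonneg (sq_nonneg (f.eval l))]

section Cyclic

variable {V : Type*} [NormedAddCommGroup V] [NormedSpace ℂ V] [CompleteSpace V] [Nontrivial V]
variable {a : J} {ι : V →ₗᵢ[ℂ] J} {S : V →L[ℂ] V} {v : V}

theorem abs_mul_sq_le_half {τ m M R l : ℝ} (n : ℕ) (hτ : 0 ≤ τ) (hτM : τ * M ≤ 1)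
    (hm : -m ≤ l) (hM : l ≤ M) (hM0 : 0 ≤ M) (hR : 4 * M + 1 ≤ R)
    (hRm : R = m * ((1 + τ * m) ^ n) ^ 2) :
    |l| * ((1 - τ * l) ^ n + R⁻¹ * (l * ((1 - τ * l) ^ n) ^ 2 * (1 - τ * l) ^ n)) ^ 2 ≤
      R / 2 := by
  have hR0 : 0 < R := by linarith
  have hb : 0 ≤ 1 - τ * l := by nlinarith
  set F := (1 - τ * l) ^ n with hF
  have hF0 : 0 ≤ F := pow_nonneg hb n
  rcases le_or_gt 0 l with hl | hl
  · have hF1 : F ≤ 1 := pow_le_one₀ hb (by nlinarith)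
    have hF2 : F ^ 2 * F ≤ 1 := by
      have : F ^ 2 ≤ 1 := pow_le_one₀ hF0 hF1
      nlinarith
    have hq : R⁻¹ * (l * F ^ 2 * F) ≤ 1 / 4 := by
      rw [inv_mul_le_iff₀ hR0]
      nlinarith [mul_le_mul_of_nonneg_left hF2 hl]
    have hq0 : 0 ≤ R⁻¹ * (l * F ^ 2 * F) := by positivity
    have hsq : (F + R⁻¹ * (l * F ^ 2 * F)) ^ 2 ≤ (5 / 4) ^ 2 :=
      pow_le_pow_left₀ (by positivity) (by linarith) 2
    rw [abs_of_nonneg hl]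
    nlinarith [mul_le_mul_of_nonneg_left hsq hl]
  · have hm0 : 0 < m := by linarith
    have hFm : F ≤ (1 + τ * m) ^ n := pow_le_pow_left₀ hb (by nlinarith) n
    have hle : -l * F ^ 2 ≤ R := by
      rw [hRm]
      exact mul_le_mul (by linarith) (pow_le_pow_left₀ hF0 hFm 2) (by positivity) hm0.le
    obtain ⟨y, hy⟩ : ∃ y, y = -l * F ^ 2 / R := ⟨_, rfl⟩
    have hy0 : 0 ≤ y := by rw [hy]; exact div_nonneg (mul_nonneg (by linarith) (sq_nonneg F)) hR0.le
    have hy1 : y ≤ 1 := by rw [hy, div_le_one hR0]; exact hle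
    have e : |l| * (F + R⁻¹ * (l * F ^ 2 * F)) ^ 2 = R * (y * (1 - y) ^ 2) := by
      rw [hy, abs_of_neg hl]; field_simp; ring
    rw [e]
    have : y * (1 - y) ^ 2 ≤ 1 / 2 := by
      nlinarith [mul_nonneg hy0 (sub_nonneg.2 hy1), sq_nonneg (y - 1 / 2)]
    nlinarith

theorem re_nonneg_of_mem_spectrum (h : IsPosTriple D) (hS : IsCyclic (D a a) a ι S v) {z : ℂ}
    (hz : z ∈ spectrum ℂ S) : 0 ≤ z.re := by
  by_contra! hneg
  obtain ⟨z₀, hz₀, hmin⟩ := (spectrum.isCompact S).exists_isMinOn ⟨z, hz⟩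
    Complex.continuous_re.continuousOn
  obtain ⟨m, hm⟩ : ∃ m, m = -z₀.re := ⟨_, rfl⟩
  have hm0 : 0 < m := by have : z₀.re ≤ z.re := hmin hz; linarith
  have hreal : ∀ w ∈ spectrum ℂ S, w = (w.re : ℂ) := fun w hw =>
    Complex.ext rfl (by simpa using hS.im_eq_zero h.toIsJBTriple hw)
  obtain ⟨M, hM⟩ : ∃ M, M = ‖S‖ := ⟨_, rfl⟩
  have hM0 : 0 ≤ M := hM ▸ norm_nonneg S
  obtain ⟨τ, hτ⟩ : ∃ τ, τ = (M + 1)⁻¹ := ⟨_, rfl⟩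
  have hτ0 : 0 < τ := by rw [hτ]; positivity
  have hτM : τ * M ≤ 1 := by rw [hτ, inv_mul_le_iff₀ (by positivity)]; linarith
  obtain ⟨n, hn⟩ := pow_unbounded_of_one_lt ((4 * M + 1) / m)
    (by nlinarith : (1 : ℝ) < 1 + τ * m)
  set f : ℝ[X] := (1 - C τ * X) ^ n with hf
  have hev : ∀ l, f.eval l = (1 - τ * l) ^ n := fun l => by simp [hf]
  obtain ⟨R, hR⟩ : ∃ R, R = m * ((1 + τ * m) ^ n) ^ 2 := ⟨_, rfl⟩
  have hRM : 4 * M + 1 ≤ R := by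
    rw [div_lt_iff₀ hm0] at hn
    have h1 : (1 : ℝ) ≤ (1 + τ * m) ^ n := one_le_pow₀ (by nlinarith)
    rw [hR]
    nlinarith
  have hNf : R ≤ ‖aeval (D a a) f a‖ ^ 2 := by
    refine le_trans (le_of_eq ?_) (hS.norm_le_of_mem_spectrum h.toIsJBTriple f hz₀)
    rw [hreal z₀ hz₀, norm_aeval_ofReal, hev, hR, hm, abs_of_nonpos (by linarith)]
    ring
  have hfg : ‖aeval (D a a) f a‖ ≤ ‖aeval (D a a) (f + C R⁻¹ * (X * f ^ 2 * f)) a‖ := by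
    have e : aeval (D a a) (f + C R⁻¹ * (X * f ^ 2 * f)) a = aeval (D a a) f a +
        ((R⁻¹ : ℝ) : ℂ) • D (aeval (D a a) f a) (aeval (D a a) f a) (aeval (D a a) f a) := by
      rw [h.cube_aeval, map_add, map_mul (aeval (D a a)) (C R⁻¹), aeval_C,
        Algebra.algebraMap_eq_smul_one, smul_mul_assoc, one_mul]
      rfl
    rw [e]
    exact h.norm_le_add_cube _ _ (inv_nonneg.2 (by linarith))
  have hNg : ‖aeval (D a a) (f + C R⁻¹ * (X * f ^ 2 * f)) a‖ ^ 2 ≤ R / 2 := by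
    refine hS.norm_sq_le_of_spectrum h.toIsJBTriple _ (by linarith) fun w hw => ?_
    have hwM := (Complex.re_le_norm w).trans (spectrum.norm_le_norm_of_mem hw)
    have hwm : z₀.re ≤ w.re := hmin hw
    rw [hreal w hw, norm_aeval_ofReal]
    simp only [eval_add, eval_mul, eval_C, eval_pow, eval_X, hev]
    exact abs_mul_sq_le_half n hτ0.le hτM (by linarith) (hM ▸ hwM) hM0 hRM hR
  have := pow_le_pow_left₀ (norm_nonneg _) hfg 2
  linarith

theorem norm_sq_le_of_isCyclic (h : IsPosTriple D) (hS : IsCyclic (D a a) a ι S v) (f : ℝ[X])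
    {s : ℝ} (hs : ∀ x ∈ Set.Icc 0 ‖D a a‖, x * f.eval x ^ 2 ≤ s) :
    ‖aeval (D a a) f a‖ ^ 2 ≤ s := by
  refine hS.norm_sq_le_of_spectrum h.toIsJBTriple f
    (by simpa using hs 0 ⟨le_rfl, norm_nonneg _⟩) fun w hw => ?_
  have hw0 := h.re_nonneg_of_mem_spectrum hS hw
  have hSn : ‖S‖ ≤ ‖D a a‖ := S.opNorm_le_bound (norm_nonneg _) fun x => by
    rw [← ι.norm_map, hS.apply, ← ι.norm_map x]; exact (D a a).le_opNorm _
  have hw1 := ((Complex.re_le_norm w).trans (spectrum.norm_le_norm_of_mem hw)).trans hSn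
  have e : w = (w.re : ℂ) := Complex.ext rfl (by simpa using hS.im_eq_zero h.toIsJBTriple hw)
  rw [e, norm_aeval_ofReal, abs_of_nonneg hw0]
  exact hs _ ⟨hw0, hw1⟩

end Cyclic

theorem map_oddPow_even_eq_zero (h : IsJBTriple D) {a b : J} (hb : D a a b = 0) (k : ℕ) :
    D (oddPow D a (2 * k)) a b = 0 := by
  induction k with
  | zero => exact hb
  | succ k ih =>
    set n := 2 * k
    have e1 := h.add_comp (oddPow D a (n + 1)) a a b
    have e2 : D a a (D (oddPow D a (n + 1)) a b) = D (oddPow D a (n + 1)) a (D a a b) :=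
      congrArg (· b) (h.commute_oddPow a (n + 1)).eq
    have e3 : D a (oddPow D a n) = D (oddPow D a n) a := by
      have := h.map_oddPow a 0 n
      rwa [zero_add, oddPow_zero] at this
    have e4 : ∀ y, D (oddPow D a (n + 1)) y a = D a (D (oddPow D a n) a y) a := fun y => by
      have h1 := h.jordan a (oddPow D a n) a y a
      rw [h.quad_oddPow, ← h.quad_left, h.symm a y] at h1
      linear_combination (norm := module) (-1 / 2 : ℂ) • h1
    rw [e2, hb, map_zero, add_zero, h.symm (oddPow D a (n + 1)) a a, ← oddPow_succ, e4, ← e3,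
      ← h.quad_left, ih, h.zero_mid, zero_apply, h.zero_mid, zero_apply, add_zero] at e1
    exact e1.symm

theorem map_aeval_expand_eq_zero (h : IsJBTriple D) {a b : J} (hb : D a a b = 0) (g : ℝ[X]) :
    D (aeval (D a a) (expand ℝ 2 g) a) a b = 0 := by
  induction g using Polynomial.induction_on' with
  | add p q hp hq => rw [map_add, aeval_add_apply, h.add_left, add_apply, hp, hq, add_zero]
  | monomial n r =>
    rw [expand_monomial, aeval_monomial_apply, h.smul_left, smul_apply, mul_comm n,
      map_oddPow_even_eq_zero h hb, smul_zero]

variable [CompleteSpace J]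

theorem norm_aeval_sq_le (h : IsPosTriple D) (a : J) (f : ℝ[X]) {s : ℝ}
    (hs : ∀ x ∈ Set.Icc 0 ‖D a a‖, x * f.eval x ^ 2 ≤ s) : ‖aeval (D a a) f a‖ ^ 2 ≤ s := by
  rcases eq_or_ne a 0 with ha | ha
  · have : 0 ≤ s := by simpa using hs 0 ⟨le_rfl, norm_nonneg _⟩
    rw [ha, map_zero]; simpa
  let E : ℂ[X] →ₗ[ℂ] J :=
    { toFun := fun p => aeval (D a a) p a
      map_add' := fun p q => by rw [map_add]; rfl
      map_smul' := fun r p => by rw [map_smul]; rfl }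
  let W : Submodule ℂ J := (LinearMap.range E).topologicalClosure
  have hcl : ∀ x : W, D a a x ∈ W := fun x => by
    refine map_mem_closure (D a a).continuous x.2 ?_
    rintro _ ⟨p, rfl⟩
    exact ⟨X * p, by simp [E]⟩
  have haW : a ∈ W := subset_closure ⟨1, by simp [E]⟩
  let S : W →L[ℂ] W := ((D a a).comp W.subtypeL).codRestrict W hcl
  have hS : IsCyclic (D a a) a W.subtypeₗᵢ S ⟨a, haW⟩ :=
    { apply := fun x => rfl
      base := rfl
      dense := by
        refine Subtype.dense_iff.2 (closure_mono ?_)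
        rintro _ ⟨p, rfl⟩
        exact ⟨aeval S p ⟨a, haW⟩, ⟨p, rfl⟩,
          map_aeval_of_map_eq (ι := W.subtypeₗᵢ) (T := D a a) (fun _ => rfl) p ⟨a, haW⟩⟩ }
  have : Nontrivial W := nontrivial_of_ne ⟨a, haW⟩ 0 fun h0 => ha (congrArg Subtype.val h0)
  have : CompleteSpace W := (LinearMap.range E).isClosed_topologicalClosure.completeSpace_coe
  exact h.norm_sq_le_of_isCyclic hS f hs

theorem map_cube_eq_zero (h : IsPosTriple D) {a b : J} (hb : D a a b = 0) :
    D (D a a a) a b = 0 := by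
  have key : ∀ ε : ℝ, 0 < ε →
      ‖D (D a a a) a b‖ ≤ ε * (3 * √‖D a a‖ * ‖a‖ * ‖b‖) := by
    intro ε hε
    obtain ⟨g, hg⟩ := exists_polynomial_near_of_continuousOn 0 (‖D a a‖ ^ 2) Real.sqrt
      Real.continuous_sqrt.continuousOn ε hε
    have hN : ‖aeval (D a a) (X - expand ℝ 2 g) a‖ ^ 2 ≤ ‖D a a‖ * ε ^ 2 := by
      refine h.norm_aeval_sq_le a _ fun x hx => ?_
      have h1 := hg (x ^ 2) ⟨sq_nonneg x, pow_le_pow_left₀ hx.1 hx.2 2⟩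
      rw [Real.sqrt_sq hx.1, abs_sub_comm] at h1
      rw [eval_sub, eval_X, expand_eval, ← sq_abs]
      exact mul_le_mul hx.2 (pow_le_pow_left₀ (abs_nonneg _) h1.le 2) (sq_nonneg _)
        (norm_nonneg _)
    have e : D (D a a a) a b = D (aeval (D a a) (X - expand ℝ 2 g) a) a b := by
      rw [map_sub, aeval_X, sub_apply, h.sub_left, sub_apply,
        map_aeval_expand_eq_zero h.toIsJBTriple hb, sub_zero]
    have hN' : ‖aeval (D a a) (X - expand ℝ 2 g) a‖ ≤ √‖D a a‖ * ε := by
      refine abs_le_of_sq_le_sq' ?_ (by positivity) |>.2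
      rwa [mul_pow, Real.sq_sqrt (norm_nonneg _)]
    rw [e]
    refine (h.norm_le _ _ _).trans ?_
    calc _ ≤ 3 * (√‖D a a‖ * ε) * ‖a‖ * ‖b‖ := by gcongr
      _ = _ := by ring
  obtain ⟨c, hc⟩ : ∃ c, c = 3 * √‖D a a‖ * ‖a‖ * ‖b‖ := ⟨_, rfl⟩
  have hc0 : 0 ≤ c := by rw [hc]; positivity
  refine norm_le_zero_iff.1 (le_of_forall_pos_le_add fun ε hε => ?_)
  refine (key (ε / (c + 1)) (by positivity)).trans ?_
  rw [← hc, zero_add, div_mul_eq_mul_div, div_le_iff₀ (by positivity)]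
  nlinarith

theorem eq_zero_of_apply_self_eq_zero (h : IsPosTriple D) {a b : J} (hb : D a a b = 0) :
    D a b = 0 :=
  h.toIsJBTriple.eq_zero_of_apply_self_eq_zero (fun _ => h.map_cube_eq_zero) hb

end IsPosTriple

/-- `IsJBStarAlgebra m st` says that `m` and `st` are the Jordan product and the involution of a
JB*-algebra structure on the complex normed space `J`. -/
structure IsJBStarAlgebra {J : Type*} [NormedAddCommGroup J] [NormedSpace ℂ J]
    (m : J →L[ℂ] J →L[ℂ] J) (st : J → J) : Prop where
  comm : ∀ x y, m x y = m y x
  jordan : ∀ x y, m (m x y) (m x x) = m x (m y (m x x))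
  norm_le : ∀ x y, ‖m x y‖ ≤ ‖x‖ * ‖y‖
  st_st : ∀ x, st (st x) = x
  st_add : ∀ x y, st (x + y) = st x + st y
  st_smul : ∀ (r : ℂ) x, st (r • x) = (starRingEnd ℂ r) • st x
  st_mul : ∀ x y, st (m x y) = m (st x) (st y)
  norm_st : ∀ x, ‖st x‖ = ‖x‖
  norm_cube : ∀ x, ‖m (m x (st x)) x + m (m x (st x)) x - m (m x x) (st x)‖ = ‖x‖ ^ 3

namespace IsJBStarAlgebra

variable {J : Type*} [NormedAddCommGroup J] [NormedSpace ℂ J]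
  {m : J →L[ℂ] J →L[ℂ] J} {st : J → J}

/-- The triple product of a JB*-algebra, as an operator in its last argument. -/
noncomputable def triple (m : J →L[ℂ] J →L[ℂ] J) (st : J → J) (x y : J) : J →L[ℂ] J :=
  m (m x (st y)) + (m x).comp (m (st y)) - (m (st y)).comp (m x)

theorem triple_apply (x y z : J) :
    triple m st x y z = m (m x (st y)) z + m x (m (st y) z) - m (st y) (m x z) := rfl

theorem linearized_jordan (h : IsJBStarAlgebra m st) (x y z w : J) :
    m x (m w (m y z)) + m y (m w (m x z)) + m z (m w (m x y)) =
      m (m x w) (m y z) + m (m y w) (m x z) + m (m z w) (m x y) := by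
  have h1 := h.jordan x w
  have h2 := h.jordan y w
  have h3 := h.jordan z w
  have h4 := h.jordan (x + y) w
  have h5 := h.jordan (x + z) w
  have h6 := h.jordan (y + z) w
  have h7 := h.jordan (x + y + z) w
  simp only [map_add, add_apply, h.comm y x, h.comm z x, h.comm z y] at h4 h5 h6 h7
  linear_combination (norm := module)
    (-1 / 2 : ℂ) • (h7 - h4 - h5 - h6 + h1 + h2 + h3)

theorem commutator_mul (h : IsJBStarAlgebra m st) (x y u v : J) :
    m x (m y (m u v)) - m y (m x (m u v)) =
      m (m x (m y u) - m y (m x u)) v + m u (m x (m y v) - m y (m x v)) := by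
  have h1 := h.linearized_jordan x u v y
  have h2 := h.linearized_jordan y u v x
  rw [h.comm (m x (m y u) - m y (m x u)) v]
  simp only [map_sub]
  rw [h.comm x y, h.comm u y, h.comm v y, h.comm (m y u) (m x v), h.comm (m y v) (m x u)] at h1
  rw [h.comm u x, h.comm v x] at h2
  linear_combination (norm := module) h1 - h2

theorem mul_linTriple (h : IsJBStarAlgebra m st) (p u v w : J) :
    m p (m (m u v) w + m u (m v w) - m v (m u w)) =
      m (m (m p u) v) w + m (m p u) (m v w) - m v (m (m p u) w)
      - (m (m u (m p v)) w + m u (m (m p v) w) - m (m p v) (m u w))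
      + (m (m u v) (m p w) + m u (m v (m p w)) - m v (m u (m p w))) := by
  have h1 := h.linearized_jordan p u v w
  have h2 := h.linearized_jordan p w v u
  have h3 := h.linearized_jordan p u w v
  simp only [map_add, map_sub]
  simp only [h.comm] at h1 h2 h3 ⊢
  linear_combination (norm := module) h1 + h2 - h3

theorem linTriple_jordan (h : IsJBStarAlgebra m st) {B : J → J → J → J}
    (hB : ∀ x y z, B x y z = m (m x y) z + m x (m y z) - m y (m x z)) (x y u v w : J) :
    B x y (B u v w) = B (B x y u) v w - B u (B y x v) w + B u v (B x y w) := by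
  obtain ⟨d, hd⟩ : ∃ d : J →L[ℂ] J, ∀ z, d z = m x (m y z) - m y (m x z) :=
    ⟨(m x).comp (m y) - (m y).comp (m x), fun _ => rfl⟩
  have hd' : ∀ u v, d (m u v) = m (d u) v + m u (d v) := fun u v => by
    simp only [hd, h.commutator_mul x y u v]
  have h1 : ∀ z, B x y z = m (m x y) z + d z := fun z => by rw [hB, hd]; abel
  have h2 : ∀ z, B y x z = m (m x y) z - d z := fun z => by rw [hB, hd, h.comm y x]; abel
  rw [h1, h1, h1, h2, hB u v w]
  have h3 := h.mul_linTriple (m x y) u v w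
  simp only [hB, map_add, map_sub, add_apply, sub_apply, hd'] at h3 ⊢
  linear_combination (norm := module) h3

theorem st_sub (h : IsJBStarAlgebra m st) (x y : J) : st (x - y) = st x - st y := by
  rw [eq_sub_iff_add_eq, ← h.st_add, sub_add_cancel]

theorem st_triple (h : IsJBStarAlgebra m st) (x y z : J) :
    st (triple m st x y z) = triple m st (st x) (st y) (st z) := by
  simp only [triple_apply, h.st_add, h.st_sub, h.st_mul]

theorem isJBTriple (h : IsJBStarAlgebra m st) : IsJBTriple (triple m st) where
  add_left x y z := by
    ext w
    simp only [triple_apply, add_apply, map_add]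
    module
  smul_left r x y := by
    ext w
    simp only [triple_apply, smul_apply, map_smul]
    module
  add_mid x y z := by
    ext w
    simp only [triple_apply, add_apply, map_add, h.st_add]
    module
  smul_mid r x y := by
    ext w
    simp only [triple_apply, smul_apply, map_smul, h.st_smul]
    module
  symm x y z := by
    rw [triple_apply, triple_apply, h.comm (m x (st y)) z, h.comm x (m (st y) z), h.comm x (st y),
      h.comm z (st y), h.comm x z]
    abel
  jordan x y u v w := by
    have := h.linTriple_jordan (B := fun x y z => m (m x y) z + m x (m y z) - m y (m x z))
      (fun _ _ _ => rfl) x (st y) u (st v) w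
    have h2 := h.st_triple y x v
    simp only [triple_apply] at this h2 ⊢
    rw [h2, h.st_st]
    exact this
  norm_le x y z := by
    have h0 := h.norm_st y
    rw [triple_apply]
    have h1 : ‖m (m x (st y)) z‖ ≤ ‖x‖ * ‖y‖ * ‖z‖ := by
      refine (h.norm_le _ _).trans ?_
      rw [← h0]
      gcongr
      exact h.norm_le _ _
    have h2 : ‖m x (m (st y) z)‖ ≤ ‖x‖ * (‖y‖ * ‖z‖) := by
      refine (h.norm_le _ _).trans ?_
      rw [← h0]
      gcongr
      exact h.norm_le _ _
    have h3 : ‖m (st y) (m x z)‖ ≤ ‖y‖ * (‖x‖ * ‖z‖) := by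
      refine (h.norm_le _ _).trans ?_
      rw [h0]
      gcongr
      exact h.norm_le _ _
    refine (norm_sub_le _ _).trans ?_
    have := norm_add_le (m (m x (st y)) z) (m x (m (st y) z))
    linarith
  norm_cube x := by
    rw [← h.norm_cube x, triple_apply, h.comm x (m (st x) x), h.comm (st x) x,
      h.comm (st x) (m x x)]

theorem st_unit (h : IsJBStarAlgebra m st) {e : J} (he : ∀ x, m e x = x) : st e = e := by
  have h1 := congrArg st (he (st e))
  rw [h.st_mul, h.st_st, h.comm, he] at h1
  exact h1

theorem norm_unit_le (h : IsJBStarAlgebra m st) {e : J} (he : ∀ x, m e x = x) : ‖e‖ ≤ 1 := by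
  have h1 := h.norm_cube e
  simp only [h.st_unit he, he, add_sub_cancel_right] at h1
  by_contra! hc
  nlinarith [mul_pos (sub_pos.2 hc) (sub_pos.2 hc), sq_nonneg ‖e‖]

theorem isDer_mul (h : IsJBStarAlgebra m st) {x : J} (hx : st x = x) :
    IsJBTriple.IsDer (triple m st) (Complex.I • m x) := by
  intro u v w
  have h1 := h.mul_linTriple x u (st v) w
  simp only [triple_apply, smul_apply, h.st_smul, h.st_mul, hx, Complex.conj_I, map_smul] at h1 ⊢
  rw [h1]
  module

theorem nonneg_of_forall_neg_mul_le {K r : ℝ} (hr : ∀ s, 0 < s → s ≤ 1 → -(K * s) ≤ r) :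
    0 ≤ r := by
  have h1 : Filter.Tendsto (fun s : ℝ => -(K * s)) (nhdsWithin 0 (Set.Ioi 0)) (nhds 0) := by
    have : Continuous fun s : ℝ => -(K * s) := by fun_prop
    simpa using (this.tendsto 0).mono_left nhdsWithin_le_nhds
  refine le_of_tendsto h1 ?_
  filter_upwards [Ioc_mem_nhdsGT (zero_lt_one' ℝ)] with s hs using hr s hs.1 hs.2

theorem exists_norm_taylorTwo_le (h : IsJBStarAlgebra m st) {e x : J} (he : ∀ x, m e x = x)
    (hx : st x = x) : ∃ K, 0 ≤ K ∧ ∀ s : ℝ, |s| ≤ 1 → ∀ z,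
      ‖IsJBTriple.taylorTwo (Complex.I • m x) s z‖ ≤ (1 + K * |s| ^ 3) * ‖z‖ ∧
      ‖z + (s : ℂ) • Complex.I • m x z - ((s ^ 2 / 2 : ℝ) : ℂ) • m (m x x) z‖ ≤
        (1 + K * |s| ^ 3) * ‖z‖ := by
  obtain ⟨K, hK, hs⟩ := (h.isDer_mul hx).exists_norm_taylorTwo_le h.isJBTriple
  refine ⟨K, hK, fun s hs1 z => ⟨ContinuousLinearMap.le_of_opNorm_le _ (hs s hs1) z, ?_⟩⟩
  have h1 := ContinuousLinearMap.le_of_opNorm_le _ (hs s hs1) e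
  have h2 : z + (s : ℂ) • Complex.I • m x z - ((s ^ 2 / 2 : ℝ) : ℂ) • m (m x x) z =
      m (IsJBTriple.taylorTwo (Complex.I • m x) s e) z := by
    rw [IsJBTriple.taylorTwo_apply]
    simp only [smul_apply, map_smul, map_add, add_apply, he, h.comm x e]
    rw [smul_smul Complex.I Complex.I, Complex.I_mul_I]
    module
  rw [h2]
  refine (h.norm_le _ _).trans ?_
  have h3 := h.norm_unit_le he
  gcongr
  refine h1.trans (mul_le_of_le_one_right ?_ h3)
  positivity

section Functional

variable {f : J →L[ℂ] ℂ} {z : J}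

theorem re_mul_sq_nonneg (h : IsJBStarAlgebra m st) {e x : J} (he : ∀ x, m e x = x)
    (hx : st x = x) (hf : ∀ y, (f y).re ≤ ‖y‖) (hz : f z = ‖z‖) :
    0 ≤ (f (m (m x x) z)).re := by
  obtain ⟨K, hK, hs⟩ := h.exists_norm_taylorTwo_le he hx
  refine nonneg_of_forall_neg_mul_le (K := 2 * K * ‖z‖) fun s h0 h1 => ?_
  have h2 := (hf _).trans (hs s (by rwa [abs_of_pos h0]) z).2
  have h3 := (hf _).trans (hs (-s) (by rwa [abs_neg, abs_of_pos h0]) z).2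
  rw [abs_neg] at h3
  rw [abs_of_pos h0] at h2 h3
  simp only [map_add, map_sub, map_smul, hz, Complex.add_re, Complex.sub_re, smul_eq_mul,
    Complex.re_ofReal_mul, Complex.ofReal_re, neg_sq] at h2 h3
  have h4 : -(2 * K * ‖z‖ * s) * s ^ 2 ≤ (f (m (m x x) z)).re * s ^ 2 := by linarith
  exact le_of_mul_le_mul_right h4 (by positivity)

theorem re_mul_mul_le_re_mul_sq (h : IsJBStarAlgebra m st) {e x : J} (he : ∀ x, m e x = x)
    (hx : st x = x) (hf : ∀ y, (f y).re ≤ ‖y‖) (hz : f z = ‖z‖) :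
    (f (m x (m x z))).re ≤ (f (m (m x x) z)).re := by
  obtain ⟨K, hK, hs⟩ := h.exists_norm_taylorTwo_le he hx
  have hb : ∀ s : ℝ, |s| ≤ 1 →
      (f (IsJBTriple.taylorTwo (Complex.I • m x) (-s)
        (z + (s : ℂ) • Complex.I • m x z - ((s ^ 2 / 2 : ℝ) : ℂ) • m (m x x) z))).re ≤
      (1 + (2 * K + K ^ 2) * |s| ^ 3) * ‖z‖ := fun s hs1 => by
    refine (hf _).trans (((hs (-s) (by rwa [abs_neg]) _).1.trans
      (mul_le_mul_of_nonneg_left (hs s hs1 z).2 (by positivity))).trans ?_)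
    rw [abs_neg, ← mul_assoc]
    gcongr
    have : (|s| ^ 3) ^ 2 ≤ |s| ^ 3 :=
      pow_le_of_le_one (by positivity) (pow_le_one₀ (abs_nonneg s) hs1) two_ne_zero
    nlinarith [sq_nonneg K]
  have he : ∀ s : ℝ, IsJBTriple.taylorTwo (Complex.I • m x) (-s)
        (z + (s : ℂ) • Complex.I • m x z - ((s ^ 2 / 2 : ℝ) : ℂ) • m (m x x) z) =
      z - ((s ^ 2 / 2 : ℝ) : ℂ) • (m (m x x) z - m x (m x z)) +
        ((s ^ 3 / 2 : ℝ) : ℂ) • Complex.I • (m x (m (m x x) z) - m x (m x (m x z))) +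
        ((s ^ 4 / 4 : ℝ) : ℂ) • m x (m x (m (m x x) z)) := fun s => by
    rw [IsJBTriple.taylorTwo_apply]
    simp only [smul_apply, map_smul, map_add, map_sub, neg_sq]
    push_cast
    match_scalars <;> ring_nf <;> simp [Complex.I_sq] <;> ring_nf
  rw [← sub_nonneg]
  set R := (f (m x (m x (m (m x x) z)))).re
  refine nonneg_of_forall_neg_mul_le (K := 2 * (2 * K + K ^ 2) * ‖z‖ + |R|) fun s h0 h1 => ?_
  have h2 := hb s (by rwa [abs_of_pos h0])
  have h3 := hb (-s) (by rwa [abs_neg, abs_of_pos h0])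
  rw [he, abs_of_pos h0] at h2
  rw [he, abs_neg, abs_of_pos h0] at h3
  simp only [map_add, map_sub, map_smul, hz, Complex.add_re, Complex.sub_re, smul_eq_mul,
    Complex.re_ofReal_mul, Complex.ofReal_re, neg_sq] at h2 h3
  rw [show (-s) ^ 4 = s ^ 4 by ring, show (-s) ^ 3 = -s ^ 3 by ring] at h3
  have h5 : -(|R| * s) ≤ R * s ^ 2 := by
    nlinarith [neg_abs_le R, abs_nonneg R, mul_nonneg (abs_nonneg R) h0.le]
  have h6 : -((2 * (2 * K + K ^ 2) * ‖z‖ + |R|) * s) * s ^ 2 ≤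
      ((f (m (m x x) z)).re - (f (m x (m x z))).re) * s ^ 2 := by
    nlinarith [mul_le_mul_of_nonneg_right h5 (sq_nonneg s),
      mul_nonneg (mul_nonneg (abs_nonneg R) h0.le) (sq_nonneg s)]
  exact le_of_mul_le_mul_right h6 (by positivity)

theorem re_triple_nonneg (h : IsJBStarAlgebra m st) {e : J} (he : ∀ x, m e x = x)
    (hf : ∀ y, (f y).re ≤ ‖y‖) (hz : f z = ‖z‖) : 0 ≤ (f (triple m st z z z)).re := by
  obtain ⟨x, hxd⟩ : ∃ x, x = (1 / 2 : ℂ) • (z + st z) := ⟨_, rfl⟩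
  obtain ⟨y, hyd⟩ : ∃ y, y = (-Complex.I / 2) • (z - st z) := ⟨_, rfl⟩
  have hx : st x = x := by
    rw [hxd, h.st_smul, h.st_add, h.st_st, add_comm]
    simp [Complex.conj_ofNat]
  have hy : st y = y := by
    rw [hyd, h.st_smul, h.st_sub, h.st_st, ← neg_sub z, smul_neg, ← neg_smul]
    simp [neg_div, Complex.conj_ofNat]
  have h1 := h.re_mul_sq_nonneg he hx hf hz
  have h2 := h.re_mul_sq_nonneg he hy hf hz
  have h3 := h.re_mul_mul_le_re_mul_sq he hx hf hz
  have h4 := h.re_mul_mul_le_re_mul_sq he hy hf hz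
  have h5 : m (m x x) z + m (m y y) z = m z (m (st z) z) := by
    simp only [hxd, hyd, map_smul, map_add, map_sub, add_apply, sub_apply, smul_apply]
    rw [h.comm (st z) z, h.comm z (m z (st z))]
    match_scalars <;> ring_nf <;> simp [Complex.I_sq] <;> ring_nf
  have h6 : m x (m x z) + m y (m y z) =
      (1 / 2 : ℂ) • (m z (m (st z) z) + m (st z) (m z z)) := by
    simp only [hxd, hyd, map_smul, map_add, map_sub, add_apply, sub_apply, smul_apply]
    match_scalars <;> ring_nf <;> simp [Complex.I_sq] <;> ring_nf
  have h7 : triple m st z z z = (2 : ℂ) • m z (m (st z) z) - m (st z) (m z z) := by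
    rw [triple_apply, h.comm (m z (st z)) z, h.comm z (st z)]
    module
  have h8 := congrArg (fun y => (f y).re) h5
  have h9 := congrArg (fun y => (f y).re) h6
  simp only [map_add, map_smul, Complex.add_re, smul_eq_mul] at h8 h9
  rw [h7]
  norm_num at h9 ⊢
  linarith

end Functional

theorem isPosTriple (h : IsJBStarAlgebra m st) {e : J} (he : ∀ x, m e x = x) :
    IsPosTriple (triple m st) where
  toIsJBTriple := h.isJBTriple
  norm_le_add_cube t x ht := by
    obtain ⟨f, hf, hx⟩ : ∃ f : J →L[ℂ] ℂ, ‖f‖ ≤ 1 ∧ f x = (‖x‖ : ℂ) := exists_dual_vector'' ℂ x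
    have hf' : ∀ y, (f y).re ≤ ‖y‖ := fun y =>
      (Complex.re_le_norm _).trans ((f.le_of_opNorm_le hf y).trans_eq (one_mul _))
    have h1 := h.re_triple_nonneg he hf' hx
    have h2 := hf' (x + (t : ℂ) • triple m st x x x)
    rw [map_add, map_smul, hx, smul_eq_mul, Complex.add_re, Complex.re_ofReal_mul,
      Complex.ofReal_re] at h2
    have h3 := mul_nonneg ht h1
    linarith

end IsJBStarAlgebra

/-- in a unital JB*-algebra, if a∘b* = 0 and (a∘a*)∘b = (a∘b)∘a* (i.e. a ⊥ b), then (c∘b*)∘a = (a∘c)∘b* for every c: a and b* operator commute. -/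
theorem stmt7
    {J : Type*} [NormedAddCommGroup J] [NormedSpace ℂ J] [CompleteSpace J]
    (jmul : J →L[ℂ] J →L[ℂ] J)
    (hcomm : ∀ a b : J, jmul a b = jmul b a)
    (hjordan : ∀ a b : J, jmul (jmul a b) (jmul a a) = jmul a (jmul b (jmul a a)))
    (hnorm : ∀ a b : J, ‖jmul a b‖ ≤ ‖a‖ * ‖b‖)
    (st : J → J)
    (hst_inv : ∀ a : J, st (st a) = a)
    (hst_add : ∀ a b : J, st (a + b) = st a + st b)
    (hst_smul : ∀ (r : ℂ) (a : J), st (r • a) = (starRingEnd ℂ r) • st a)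
    (hst_mul : ∀ a b : J, st (jmul a b) = jmul (st a) (st b))
    (hst_norm : ∀ a : J, ‖st a‖ = ‖a‖)
    (hcstar : ∀ a : J,
      ‖jmul (jmul a (st a)) a + jmul (jmul a (st a)) a - jmul (jmul a a) (st a)‖ = ‖a‖ ^ 3)
    (e : J) (he : ∀ a : J, jmul e a = a)
    (a b : J)
    (h1 : jmul a (st b) = 0)
    (h2 : jmul (jmul a (st a)) b = jmul (jmul a b) (st a)) :
    ∀ c : J, jmul (jmul c (st b)) a = jmul (jmul a c) (st b) := by
  have h : IsJBStarAlgebra jmul st :=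
    ⟨hcomm, hjordan, hnorm, hst_inv, hst_add, hst_smul, hst_mul, hst_norm, hcstar⟩
  have hba : jmul (st a) b = 0 := by
    rw [← hst_inv b, ← hst_mul, h1, ← zero_smul ℂ (0 : J), hst_smul]
    simp
  have hab : IsJBStarAlgebra.triple jmul st a a b = 0 := by
    rw [IsJBStarAlgebra.triple_apply, h2, hba, map_zero, add_zero, hcomm, sub_self]
  intro c
  have hc : IsJBStarAlgebra.triple jmul st a b c = 0 := by
    rw [(h.isPosTriple he).eq_zero_of_apply_self_eq_zero hab, zero_apply]
  rw [IsJBStarAlgebra.triple_apply, h1, map_zero, zero_apply, zero_add, sub_eq_zero] at hc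
  rw [hcomm _ a, hcomm c, hc, hcomm]
end

section
/- Let A be a commutative C*-algebra and V : A × A → ℂ a continuous anti-symmetric bilinear form that is orthogonal (V(a,b*) = 0 whenever ab* = b*a = 0). Then V = 0. -/
/-- A sum of translates of a ramp climbing from `0` to `1` over `[0, 1]` stays within `1` of the
identity. -/
theorem abs_sum_translates_sub_le_one {s : ℝ → ℝ} (h0 : ∀ y ≤ 0, s y = 0)
    (h1 : ∀ y, 1 ≤ y → s y = 1) (hs : ∀ y, s y ∈ Set.Icc (0 : ℝ) 1) (K : ℕ) :
    ∀ x : ℝ, 0 ≤ x → x ≤ K → |∑ j ∈ Finset.range K, s (x - j) - x| ≤ 1 := by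
  induction K with
  | zero =>
    intro x hx hx'
    have : x = 0 := le_antisymm (by simpa using hx') hx
    simp [this]
  | succ K ih =>
    intro x hx hx'
    push_cast at hx'
    have hshift (j : ℕ) : x - ((j + 1 : ℕ) : ℝ) = x - 1 - j := by push_cast; ring
    rw [Finset.sum_range_succ']
    simp only [hshift, Nat.cast_zero, sub_zero]
    rcases le_total x 1 with hx1 | hx1
    · have hz : ∑ j ∈ Finset.range K, s (x - 1 - j) = 0 :=
        Finset.sum_eq_zero fun j _ => h0 _ (by have := Nat.cast_nonneg (α := ℝ) j; linarith)
      have := hs x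
      rw [hz, abs_le]
      constructor <;> linarith [this.1, this.2]
    · have := ih (x - 1) (by linarith) (by linarith)
      rw [h1 x hx1]
      convert this using 2
      ring

section ZeroProduct

variable {R : Type*} [CommRing R] [Algebra ℂ R]

theorem LinearMap.map_mul_left_eq_of_mul_eq_zero (V : R →ₗ[ℂ] R →ₗ[ℂ] ℂ)
    (hV : ∀ a b, a * b = 0 → V a b = 0) {g x y : R} (h : g * (1 - g) * x = 0) :
    V (g * x) y = V x (g * y) := by
  have e1 : V (g * x) ((1 - g) * y) = 0 := hV _ _ (by linear_combination y * h)
  have e2 : V ((1 - g) * x) (g * y) = 0 := hV _ _ (by linear_combination y * h)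
  simp only [sub_mul, one_mul, map_sub, LinearMap.sub_apply] at e1 e2
  linear_combination e1 - e2

end ZeroProduct

section ContinuousFunctions

variable {X : Type*} [TopologicalSpace X]

/-- A real continuous function regarded as a complex one. -/
noncomputable def ContinuousMap.toComplex (f : C(X, ℝ)) : C(X, ℂ) :=
  ⟨fun t => (f t : ℂ), by fun_prop⟩

@[simp]
theorem ContinuousMap.toComplex_apply (f : C(X, ℝ)) (t : X) : f.toComplex t = (f t : ℂ) := rfl

variable [CompactSpace X]

/-- If `x` vanishes wherever one of the ramps is neither `0` nor `1`, then multiplication by `m`,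
being close to the sum of the ramps, almost passes through `V`. -/
theorem norm_map_mul_sub_le_of_ramp (V : C(X, ℂ) →ₗ[ℂ] C(X, ℂ) →ₗ[ℂ] ℂ) {B : ℝ} (hB : 0 ≤ B)
    (hVB : ∀ f g, ‖V f g‖ ≤ B * ‖f‖ * ‖g‖) (hV : ∀ f g, f * g = 0 → V f g = 0)
    {s : ℝ → ℝ} (hsc : Continuous s) (h0 : ∀ y ≤ 0, s y = 0)
    (h1 : ∀ y, 1 ≤ y → s y = 1) (hs : ∀ y, s y ∈ Set.Icc (0 : ℝ) 1)
    (m : C(X, ℝ)) (K : ℕ) (hm0 : ∀ t, 0 ≤ m t) (hmK : ∀ t, m t ≤ K) (x c : C(X, ℂ))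
    (hx : ∀ t, ∀ j < K, s (m t - j) * (1 - s (m t - j)) ≠ 0 → x t = 0) :
    ‖V (m.toComplex * x) c - V x (m.toComplex * c)‖ ≤ 2 * B * ‖x‖ * ‖c‖ := by
  let r (j : ℕ) : C(X, ℂ) := ContinuousMap.toComplex ⟨fun t => s (m t - j), by fun_prop⟩
  let g : C(X, ℂ) := ∑ j ∈ Finset.range K, r j
  have hg : V (g * x) c = V x (g * c) := by
    simp only [g, Finset.sum_mul, map_sum, LinearMap.sum_apply]
    refine Finset.sum_congr rfl fun j hj => V.map_mul_left_eq_of_mul_eq_zero hV ?_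
    ext t
    by_cases ht : s (m t - j) * (1 - s (m t - j)) = 0
    · have ht' : (s (m t - j) : ℂ) * (1 - (s (m t - j) : ℂ)) = 0 := by exact_mod_cast ht
      simp [r, ht']
    · simp [hx t j (Finset.mem_range.mp hj) ht]
  have hd : ‖m.toComplex - g‖ ≤ 1 := by
    rw [ContinuousMap.norm_le _ zero_le_one]
    intro t
    have := abs_sum_translates_sub_le_one h0 h1 hs K (m t) (hm0 t) (hmK t)
    rw [abs_sub_comm] at this
    have e : (m.toComplex - g) t = ((m t - ∑ j ∈ Finset.range K, s (m t - j) : ℝ) : ℂ) := by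
      simp [g, r, ContinuousMap.sum_apply]
    rw [e, Complex.norm_real]
    exact this
  have hmul (f : C(X, ℂ)) : ‖(m.toComplex - g) * f‖ ≤ ‖f‖ :=
    (norm_mul_le _ _).trans (mul_le_of_le_one_left (norm_nonneg _) hd)
  have e : V (m.toComplex * x) c - V x (m.toComplex * c)
      = V ((m.toComplex - g) * x) c - V x ((m.toComplex - g) * c) := by
    simp only [sub_mul, map_sub, LinearMap.sub_apply, hg]
    ring
  rw [e]
  calc _ ≤ ‖V ((m.toComplex - g) * x) c‖ + ‖V x ((m.toComplex - g) * c)‖ := norm_sub_le _ _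
    _ ≤ B * ‖x‖ * ‖c‖ + B * ‖x‖ * ‖c‖ := by
      refine add_le_add ((hVB _ _).trans ?_) ((hVB _ _).trans ?_)
      · gcongr; exact hmul x
      · gcongr; exact hmul c
    _ = _ := by ring

/-- The ramp climbing from `0` to `1` over `[c / 4, (c + 1) / 4]`. -/
noncomputable def quarterRamp (c y : ℝ) : ℝ := max 0 (min 1 (4 * y - c))

theorem quarterRamp_mem_Icc (c y : ℝ) : quarterRamp c y ∈ Set.Icc (0 : ℝ) 1 :=
  ⟨le_max_left _ _, max_le zero_le_one (min_le_left _ _)⟩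

theorem continuous_quarterRamp (c : ℝ) : Continuous (quarterRamp c) := by
  unfold quarterRamp
  fun_prop

theorem quarterRamp_eq_zero {c y : ℝ} (h : 4 * y ≤ c) : quarterRamp c y = 0 :=
  max_eq_left ((min_le_right _ _).trans (by linarith))

theorem quarterRamp_eq_one {c y : ℝ} (h : c + 1 ≤ 4 * y) : quarterRamp c y = 1 := by
  rw [quarterRamp, min_eq_left (by linarith), max_eq_right zero_le_one]

theorem mem_Icc_of_quarterRamp_mul_ne_zero {c y j : ℝ}
    (h : quarterRamp c (y - j) * (1 - quarterRamp c (y - j)) ≠ 0) :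
    y ∈ Set.Icc (j + c / 4) (j + (c + 1) / 4) := by
  constructor
  · by_contra! hy
    exact h (by rw [quarterRamp_eq_zero (by linarith), zero_mul])
  · by_contra! hy
    exact h (by rw [quarterRamp_eq_one (by linarith), sub_self, mul_zero])

theorem norm_map_mul_sub_le (V : C(X, ℂ) →ₗ[ℂ] C(X, ℂ) →ₗ[ℂ] ℂ) {B : ℝ} (hB : 0 ≤ B)
    (hVB : ∀ f g, ‖V f g‖ ≤ B * ‖f‖ * ‖g‖) (hV : ∀ f g, f * g = 0 → V f g = 0)
    (m : C(X, ℝ)) (hm : ∀ t, 0 ≤ m t) (a c : C(X, ℂ)) :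
    ‖V (m.toComplex * a) c - V a (m.toComplex * c)‖ ≤ 4 * B * ‖a‖ * ‖c‖ := by
  obtain ⟨K, hK⟩ := exists_nat_ge ‖m‖
  have hmK (t : X) : m t ≤ K := (le_abs_self _).trans ((m.norm_coe_le_norm t).trans hK)
  let S (d : ℝ) : Set ℝ := ⋃ j ∈ Finset.range K, Set.Icc ((j : ℝ) + d / 4) (j + (d + 1) / 4)
  have hS (d : ℝ) : IsClosed (S d) := isClosed_biUnion_finset fun _ _ => isClosed_Icc
  have hdisj : Disjoint (S 0) (S 2) := by
    rw [Set.disjoint_left]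
    intro y hy hy'
    simp only [S, Set.mem_iUnion, Set.mem_Icc] at hy hy'
    obtain ⟨i, -, hi, hi'⟩ := hy
    obtain ⟨j, -, hj, hj'⟩ := hy'
    have hij : (i : ℝ) < (j + 1 : ℕ) := by push_cast; linarith
    have hji : (j : ℝ) < i := by linarith
    have := Nat.cast_lt.mp hij
    have := Nat.cast_lt.mp hji
    omega
  obtain ⟨p, hp0, hp1, hp⟩ := exists_continuous_zero_one_of_isClosed (hS 0) (hS 2) hdisj
  let q : C(X, ℂ) := (p.comp m).toComplex
  have key (d : ℝ) (hd : 0 ≤ d) (hd' : d ≤ 3) (e : C(X, ℂ)) (he : ‖e‖ ≤ 1)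
      (hz : ∀ t, m t ∈ S d → e t = 0) :
      ‖V (m.toComplex * (e * a)) c - V (e * a) (m.toComplex * c)‖ ≤ 2 * B * ‖a‖ * ‖c‖ := by
    have hle : ‖e * a‖ ≤ ‖a‖ :=
      (norm_mul_le _ _).trans (mul_le_of_le_one_left (norm_nonneg _) he)
    refine (norm_map_mul_sub_le_of_ramp V hB hVB hV (continuous_quarterRamp d)
      (fun y hy => quarterRamp_eq_zero (by linarith)) (fun y hy => quarterRamp_eq_one (by linarith))
      (quarterRamp_mem_Icc d) m K hm hmK (e * a) c fun t j hj hne => ?_).trans (by gcongr)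
    rw [ContinuousMap.mul_apply, hz t, zero_mul]
    simp only [S, Set.mem_iUnion]
    exact ⟨j, Finset.mem_range.mpr hj, mem_Icc_of_quarterRamp_mul_ne_zero hne⟩
  have hq := key 0 le_rfl (by norm_num) q
    ((ContinuousMap.norm_le _ zero_le_one).mpr fun t => by
      simp only [q, ContinuousMap.toComplex_apply, Complex.norm_real, Real.norm_eq_abs, abs_le,
        ContinuousMap.comp_apply]
      constructor <;> linarith [(hp (m t)).1, (hp (m t)).2])
    (fun t ht => by simp [q, hp0 ht])
  have hq' := key 2 (by norm_num) (by norm_num) (1 - q)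
    ((ContinuousMap.norm_le _ zero_le_one).mpr fun t => by
      have e : (1 - q) t = ((1 - p (m t) : ℝ) : ℂ) := by simp [q]
      rw [e, Complex.norm_real, Real.norm_eq_abs, abs_le]
      constructor <;> linarith [(hp (m t)).1, (hp (m t)).2])
    (fun t ht => by simp [q, hp1 ht])
  have e : V (m.toComplex * a) c - V a (m.toComplex * c)
      = (V (m.toComplex * (q * a)) c - V (q * a) (m.toComplex * c))
        + (V (m.toComplex * ((1 - q) * a)) c - V ((1 - q) * a) (m.toComplex * c)) := by
    simp only [sub_mul, mul_sub, one_mul, map_sub, LinearMap.sub_apply]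
    ring
  rw [e]
  linarith [norm_add_le (V (m.toComplex * (q * a)) c - V (q * a) (m.toComplex * c))
    (V (m.toComplex * ((1 - q) * a)) c - V ((1 - q) * a) (m.toComplex * c))]

theorem map_toComplex_mul_eq_of_nonneg (V : C(X, ℂ) →ₗ[ℂ] C(X, ℂ) →ₗ[ℂ] ℂ) {B : ℝ} (hB : 0 ≤ B)
    (hVB : ∀ f g, ‖V f g‖ ≤ B * ‖f‖ * ‖g‖) (hV : ∀ f g, f * g = 0 → V f g = 0)
    (m : C(X, ℝ)) (hm : ∀ t, 0 ≤ m t) (a c : C(X, ℂ)) :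
    V (m.toComplex * a) c = V a (m.toComplex * c) := by
  by_contra hne
  have hpos : 0 < ‖V (m.toComplex * a) c - V a (m.toComplex * c)‖ :=
    norm_pos_iff.mpr (sub_ne_zero.mpr hne)
  obtain ⟨n, hn⟩ := exists_nat_gt
    (4 * B * ‖a‖ * ‖c‖ / ‖V (m.toComplex * a) c - V a (m.toComplex * c)‖)
  rw [div_lt_iff₀ hpos] at hn
  have h := norm_map_mul_sub_le V hB hVB hV ((n : ℝ) • m)
    (fun t => mul_nonneg n.cast_nonneg (hm t)) a c
  have e : ((n : ℝ) • m).toComplex = (n : ℂ) • m.toComplex := by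
    ext t
    simp
  rw [e, smul_mul_assoc, smul_mul_assoc, map_smul, map_smul, LinearMap.smul_apply, ← smul_sub,
    norm_smul, Complex.norm_natCast] at h
  linarith

/-- A bounded bilinear form on `C(X, ℂ)` vanishing on pairs with zero product is balanced. -/
theorem map_mul_eq_map_mul_of_bounded (V : C(X, ℂ) →ₗ[ℂ] C(X, ℂ) →ₗ[ℂ] ℂ) {B : ℝ} (hB : 0 ≤ B)
    (hVB : ∀ f g, ‖V f g‖ ≤ B * ‖f‖ * ‖g‖) (hV : ∀ f g, f * g = 0 → V f g = 0)
    (f a c : C(X, ℂ)) : V (f * a) c = V a (f * c) := by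
  have hreal (u : C(X, ℝ)) : V (u.toComplex * a) c = V a (u.toComplex * c) := by
    have e : u.toComplex = (u ⊔ 0).toComplex - ((-u) ⊔ 0).toComplex := by
      ext t
      simp only [ContinuousMap.toComplex_apply, ContinuousMap.sub_apply, ContinuousMap.sup_apply,
        ContinuousMap.neg_apply, ContinuousMap.zero_apply]
      exact_mod_cast (posPart_sub_negPart (u t)).symm
    simp only [e, sub_mul, map_sub, LinearMap.sub_apply]
    rw [map_toComplex_mul_eq_of_nonneg V hB hVB hV (u ⊔ 0) (fun t => le_max_right _ _),
      map_toComplex_mul_eq_of_nonneg V hB hVB hV ((-u) ⊔ 0) (fun t => le_max_right _ _)]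
  have e : f = ContinuousMap.toComplex ⟨fun t => (f t).re, by fun_prop⟩
      + Complex.I • ContinuousMap.toComplex ⟨fun t => (f t).im, by fun_prop⟩ := by
    ext t
    simp [mul_comm Complex.I, Complex.re_add_im]
  rw [e]
  simp only [add_mul, smul_mul_assoc, map_add, map_smul, LinearMap.add_apply,
    LinearMap.smul_apply, hreal]

theorem eq_zero_of_antisymm_of_bounded (V : C(X, ℂ) →ₗ[ℂ] C(X, ℂ) →ₗ[ℂ] ℂ) {B : ℝ} (hB : 0 ≤ B)
    (hVB : ∀ f g, ‖V f g‖ ≤ B * ‖f‖ * ‖g‖) (hV : ∀ f g, f * g = 0 → V f g = 0)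
    (hanti : ∀ f g, V f g = -V g f) (f g : C(X, ℂ)) : V f g = 0 := by
  have hbal := map_mul_eq_map_mul_of_bounded V hB hVB hV
  have h1 : V f g = V 1 (f * g) := by simpa using hbal f 1 g
  have h2 : V (f * g) 1 = V 1 (f * g) := by simpa using hbal (f * g) 1 1
  have h3 := hanti (f * g) 1
  rw [h1]
  linear_combination (h3 - h2) / 2

end ContinuousFunctions

/-- on a commutative C*-algebra `A`, every continuous anti-symmetric
bilinear form that is orthogonal (`V(a, b*) = 0` whenever `a b* = b* a = 0`)
vanishes identically. -/
theorem stmt18 {A : Type*} [NormedCommRing A] [StarRing A] [CStarRing A]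
    [NormedAlgebra ℂ A] [CompleteSpace A] [StarModule ℂ A]
    (V : A →L[ℂ] A →L[ℂ] ℂ)
    (hanti : ∀ a b : A, V a b = - V b a)
    (horth : ∀ a b : A, a * star b = 0 → star b * a = 0 → V a (star b) = 0) :
    V = 0 := by
  let : CommCStarAlgebra A := {}
  let Φ := gelfandStarTransform A
  let L : C(WeakDual.characterSpace ℂ A, ℂ) →ₗ[ℂ] A := Φ.symm.toAlgEquiv.toLinearMap
  have hL (f) : L f = Φ.symm f := rfl
  have hnorm (f) : ‖L f‖ = ‖f‖ := by
    have := (gelfandTransform_isometry A).norm_map_of_map_zero (map_zero _) (Φ.symm f)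
    rw [hL, ← this]
    exact congrArg norm (Φ.apply_symm_apply f)
  let W : C(WeakDual.characterSpace ℂ A, ℂ) →ₗ[ℂ] C(WeakDual.characterSpace ℂ A, ℂ) →ₗ[ℂ] ℂ :=
    LinearMap.mk₂ ℂ (fun f g => V (L f) (L g)) (by simp) (by simp) (by simp) (by simp)
  have hW (f g) : W f g = V (L f) (L g) := rfl
  have hzero := eq_zero_of_antisymm_of_bounded W (norm_nonneg V)
    (fun f g => by
      rw [hW, ← hnorm f, ← hnorm g]
      exact V.le_opNorm₂ _ _)
    (fun f g hfg => by
      have h : L f * star (star (L g)) = 0 := by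
        rw [star_star, hL, hL, ← map_mul, hfg, map_zero]
      rw [hW, ← star_star (L g)]
      exact horth _ _ h (by rw [mul_comm, h]))
    (fun f g => hanti _ _)
  ext a b
  have h := hzero (Φ a) (Φ b)
  rw [hW, hL, hL, Φ.symm_apply_apply, Φ.symm_apply_apply] at h
  simpa using h
end
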